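/- Let B = B(x,R) be a ball with 0 < R < (1/12) diam X, and suppose A ⊂ B satisfies A ∩ (B(x,9R/20) ∖ B(x,R/4)) = ∅. Let E ⊂ X be a set such that χ_E is a solution of the K_{A,0}(B(x,3R/2))-obstacle problem. Then for every y with 5R/16 ≤ d(x,y) < 2R/5, one has χ_E^∨(y) ≤ C₄ R · cap₁(A, B(x,2R)) / μ(B(x,R)), where C₄ is a constant depending only on C_d, C_P, λ. -/

import Mathlib

open MeasureTheory Metric Filter Set
open scoped ENNReal NNReal Topology

noncomputable section

namespace MetricBV

variable {X : Type*} [MetricSpace X] [MeasurableSpace X]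

/-- A rectifiable curve, encoded as a Lipschitz map on the interval `[0,1]`
(every rectifiable curve admits such a reparametrization). -/
structure Curve (X : Type*) [MetricSpace X] where
  toFun : ℝ → X
  lipschitz : ∃ K : ℝ≥0, LipschitzOnWith K toFun (Set.Icc 0 1)

/-- The metric speed of a curve at a point. -/
def speed (γ : ℝ → X) (t : ℝ) : ℝ≥0∞ :=
  Filter.limsup (fun h : ℝ => ENNReal.ofReal (dist (γ (t + h)) (γ t) / |h|)) (𝓝[≠] (0 : ℝ))

/-- The curve integral `∫_γ g ds`. -/
def curveIntegral (g : X → ℝ≥0∞) (γ : Curve X) : ℝ≥0∞ :=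
  ∫⁻ t in Set.Icc (0 : ℝ) 1, g (γ.toFun t) * speed γ.toFun t

/-- A curve lies in a set `Ω`. -/
def Curve.In (γ : Curve X) (Ω : Set X) : Prop :=
  ∀ t ∈ Set.Icc (0 : ℝ) 1, γ.toFun t ∈ Ω

/-- The 1-modulus of a family of curves. -/
def Mod1 (μ : Measure X) (Γ : Set (Curve X)) : ℝ≥0∞ :=
  ⨅ (ρ : X → ℝ≥0∞) (_ : Measurable ρ) (_ : ∀ γ ∈ Γ, 1 ≤ curveIntegral ρ γ),
    ∫⁻ x, ρ x ∂μ

/-- `g` is an upper gradient of `u` in `Ω`: the upper gradient inequality holds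
along every curve contained in `Ω`. -/
def IsUpperGradientOn (g : X → ℝ≥0∞) (u : X → ℝ) (Ω : Set X) : Prop :=
  ∀ γ : Curve X, γ.In Ω →
    ENNReal.ofReal |u (γ.toFun 1) - u (γ.toFun 0)| ≤ curveIntegral g γ

/-- `g` is a 1-weak upper gradient of `u` in `Ω`: the upper gradient inequality holds
along every curve in `Ω` outside a family of zero 1-modulus. -/
def IsWeakUpperGradientOn (μ : Measure X) (g : X → ℝ≥0∞) (u : X → ℝ) (Ω : Set X) : Prop :=
  ∃ Γ : Set (Curve X), Mod1 μ Γ = 0 ∧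
    ∀ γ : Curve X, γ ∉ Γ → γ.In Ω →
      ENNReal.ofReal |u (γ.toFun 1) - u (γ.toFun 0)| ≤ curveIntegral g γ

/-- Membership in the Newtonian space `N^{1,1}(X)`. -/
def MemN11 (μ : Measure X) (u : X → ℝ) : Prop :=
  Integrable u μ ∧ ∃ g : X → ℝ≥0∞, Measurable g ∧
    IsWeakUpperGradientOn μ g u Set.univ ∧ ∫⁻ x, g x ∂μ < ⊤

/-- The 1-capacity `cap₁(A) = inf ‖u‖_{N^{1,1}(X)}` over `u ∈ N^{1,1}(X)` with `u ≥ 1` on `A`. -/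
def cap1 (μ : Measure X) (A : Set X) : ℝ≥0∞ :=
  ⨅ (u : X → ℝ) (_ : MemN11 μ u) (_ : ∀ x ∈ A, 1 ≤ u x)
    (g : X → ℝ≥0∞) (_ : Measurable g) (_ : IsWeakUpperGradientOn μ g u Set.univ),
    (∫⁻ x, ENNReal.ofReal |u x| ∂μ + ∫⁻ x, g x ∂μ)

/-- The variational 1-capacity `cap₁(A,Ω) = inf ∫ g_u dμ` over `u ∈ N^{1,1}(X)` with
`u ≥ 1` on `A` and `u = 0` on `X ∖ Ω`. -/
def vcap1 (μ : Measure X) (A Ω : Set X) : ℝ≥0∞ :=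
  ⨅ (u : X → ℝ) (_ : MemN11 μ u) (_ : ∀ x ∈ A, 1 ≤ u x) (_ : ∀ x ∈ Ωᶜ, u x = 0)
    (g : X → ℝ≥0∞) (_ : Measurable g) (_ : IsWeakUpperGradientOn μ g u Set.univ),
    ∫⁻ x, g x ∂μ

/-- Locally Lipschitz in `Ω`: Lipschitz on every compact subset of `Ω`. -/
def LocLipschitzOn (u : X → ℝ) (Ω : Set X) : Prop :=
  ∀ K : Set X, IsCompact K → K ⊆ Ω → ∃ L : ℝ≥0, LipschitzOnWith L u K

/-- Convergence `v i → u` in `L¹_loc(Ω)`. -/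
def TendstoL1Loc (μ : Measure X) (v : ℕ → X → ℝ) (u : X → ℝ) (Ω : Set X) : Prop :=
  ∀ K : Set X, IsCompact K → K ⊆ Ω →
    Filter.Tendsto (fun i => ∫⁻ x in K, ENNReal.ofReal |v i x - u x| ∂μ)
      Filter.atTop (𝓝 0)

/-- The total variation `‖Du‖(Ω)` of `u` in an open set `Ω`: the infimum of
`liminf ∫_Ω g_i dμ` over sequences of locally Lipschitz functions `v i → u` in `L¹_loc(Ω)`
with `g i` a 1-weak upper gradient of `v i` in `Ω`. -/
def tv (μ : Measure X) (u : X → ℝ) (Ω : Set X) : ℝ≥0∞ :=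
  ⨅ (v : ℕ → X → ℝ) (_ : ∀ i, LocLipschitzOn (v i) Ω) (_ : TendstoL1Loc μ v u Ω)
    (g : ℕ → X → ℝ≥0∞) (_ : ∀ i, Measurable (g i))
    (_ : ∀ i, IsWeakUpperGradientOn μ (g i) (v i) Ω),
    Filter.liminf (fun i => ∫⁻ x in Ω, g i x ∂μ) Filter.atTop

/-- The total variation `‖Du‖(A)` for an arbitrary set `A`. -/
def tvs (μ : Measure X) (u : X → ℝ) (A : Set X) : ℝ≥0∞ :=
  ⨅ (U : Set X) (_ : IsOpen U) (_ : A ⊆ U), tv μ u U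

/-- The characteristic function of a set, as a real-valued function. -/
def chi (E : Set X) : X → ℝ := Set.indicator E fun _ => (1 : ℝ)

/-- The perimeter `P(E,Ω) = ‖Dχ_E‖(Ω)` of `E` in an open set `Ω`. -/
def perim (μ : Measure X) (E : Set X) (Ω : Set X) : ℝ≥0∞ := tv μ (chi E) Ω

/-- `u ∈ BV(Ω)`: `u ∈ L¹(Ω)` and `‖Du‖(Ω) < ∞`. -/
def MemBV (μ : Measure X) (u : X → ℝ) (Ω : Set X) : Prop :=
  IntegrableOn u Ω μ ∧ tv μ u Ω < ⊤

/-- `u ∈ BV_loc(Ω)`. -/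
def MemBVloc (μ : Measure X) (u : X → ℝ) (Ω : Set X) : Prop :=
  ∀ K : Set X, IsCompact K → K ⊆ Ω → ∃ U : Set X, IsOpen U ∧ K ⊆ U ∧ U ⊆ Ω ∧ MemBV μ u U

/-- `φ ∈ BV_c(Ω)`: a BV function with compact support in `Ω`. -/
def MemBVc (μ : Measure X) (φ : X → ℝ) (Ω : Set X) : Prop :=
  MemBV μ φ Ω ∧ IsCompact (tsupport φ) ∧ tsupport φ ⊆ Ω

/-- `u` is a 1-minimizer (function of least gradient) in `Ω`. -/
def IsMinimizer (μ : Measure X) (u : X → ℝ) (Ω : Set X) : Prop :=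
  MemBVloc μ u Ω ∧ ∀ φ : X → ℝ, MemBVc μ φ Ω →
    tvs μ u (tsupport φ) ≤ tvs μ (fun y => u y + φ y) (tsupport φ)

/-- `u` is a 1-superminimizer in `Ω`. -/
def IsSuperminimizer (μ : Measure X) (u : X → ℝ) (Ω : Set X) : Prop :=
  MemBVloc μ u Ω ∧ ∀ φ : X → ℝ, MemBVc μ φ Ω → (∀ x, 0 ≤ φ x) →
    tvs μ u (tsupport φ) ≤ tvs μ (fun y => u y + φ y) (tsupport φ)

/-- `u` is a 1-subminimizer in `Ω`. -/
def IsSubminimizer (μ : Measure X) (u : X → ℝ) (Ω : Set X) : Prop :=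
  MemBVloc μ u Ω ∧ ∀ φ : X → ℝ, MemBVc μ φ Ω → (∀ x, φ x ≤ 0) →
    tvs μ u (tsupport φ) ≤ tvs μ (fun y => u y + φ y) (tsupport φ)

/-- The lower approximate limit `u^∧(x)`, with values in `[-∞,∞]`. -/
def lowerApprox (μ : Measure X) (u : X → ℝ) (x : X) : EReal :=
  sSup ((fun t : ℝ => (t : EReal)) '' {t : ℝ | Filter.Tendsto
    (fun r : ℝ => μ ({y | u y < t} ∩ Metric.ball x r) / μ (Metric.ball x r))
    (𝓝[>] (0 : ℝ)) (𝓝 0)})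

/-- The upper approximate limit `u^∨(x)`, with values in `[-∞,∞]`. -/
def upperApprox (μ : Measure X) (u : X → ℝ) (x : X) : EReal :=
  sInf ((fun t : ℝ => (t : EReal)) '' {t : ℝ | Filter.Tendsto
    (fun r : ℝ => μ ({y | t < u y} ∩ Metric.ball x r) / μ (Metric.ball x r))
    (𝓝[>] (0 : ℝ)) (𝓝 0)})

/-- The upper approximate limit of an extended-real-valued function. -/
def upperApproxE (μ : Measure X) (ψ : X → EReal) (x : X) : EReal :=
  sInf ((fun t : ℝ => (t : EReal)) '' {t : ℝ | Filter.Tendsto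
    (fun r : ℝ => μ ({y | (t : EReal) < ψ y} ∩ Metric.ball x r) / μ (Metric.ball x r))
    (𝓝[>] (0 : ℝ)) (𝓝 0)})

/-- The measure-theoretic interior `I_E`. -/
def measInterior (μ : Measure X) (E : Set X) : Set X :=
  {x : X | Filter.Tendsto (fun r : ℝ => μ (Metric.ball x r \ E) / μ (Metric.ball x r))
    (𝓝[>] (0 : ℝ)) (𝓝 0)}

/-- The measure-theoretic boundary `∂*E`. -/
def measBoundary (μ : Measure X) (E : Set X) : Set X :=
  {x : X | 0 < Filter.limsup (fun r : ℝ => μ (Metric.ball x r ∩ E) / μ (Metric.ball x r))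
      (𝓝[>] (0 : ℝ)) ∧
    0 < Filter.limsup (fun r : ℝ => μ (Metric.ball x r \ E) / μ (Metric.ball x r))
      (𝓝[>] (0 : ℝ))}

/-- `A` is 1-thin at `x`. -/
def IsThinAt (μ : Measure X) (A : Set X) (x : X) : Prop :=
  Filter.Tendsto (fun r : ℝ =>
      ENNReal.ofReal r * vcap1 μ (A ∩ Metric.ball x r) (Metric.ball x (2 * r))
        / μ (Metric.ball x r))
    (𝓝[>] (0 : ℝ)) (𝓝 0)

/-- `U` is 1-finely open. -/
def IsFinelyOpen (μ : Measure X) (U : Set X) : Prop :=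
  ∀ x ∈ U, IsThinAt μ Uᶜ x

/-- The class `K_{ψ,f}(Ω)` of admissible functions for the obstacle problem. -/
def MemK (μ : Measure X) (ψ : X → EReal) (f : X → ℝ) (Ω : Set X) (u : X → ℝ) : Prop :=
  MemBVloc μ u Set.univ ∧ (∀ᵐ x ∂μ, x ∈ Ω → ψ x ≤ (u x : EReal)) ∧
    (∀ᵐ x ∂μ, x ∉ Ω → u x = f x)

/-- `u` is a solution of the `K_{ψ,f}(Ω)`-obstacle problem. -/
def IsObstacleSolution (μ : Measure X) (ψ : X → EReal) (f : X → ℝ) (Ω : Set X)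
    (u : X → ℝ) : Prop :=
  MemK μ ψ f Ω u ∧ ∀ v : X → ℝ, MemK μ ψ f Ω v → tv μ u Set.univ ≤ tv μ v Set.univ

/-- The standing assumptions: `(X,d,μ)` is a complete metric space with at least two points,
`μ` is a doubling measure with constant `Cd`, and `X` supports a `(1,1)`-Poincaré inequality
with constants `CP`, `lam`. -/
structure MMS {X : Type*} [MetricSpace X] [MeasurableSpace X] (μ : Measure X)
    (Cd CP lam : ℝ) : Prop where
  complete : CompleteSpace X
  nontrivial : Nontrivial X
  hCd : 1 ≤ Cd
  hCP : 0 < CP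
  hlam : 1 ≤ lam
  doubling : ∀ (x : X) (r : ℝ), 0 < r →
    0 < μ (Metric.ball x (2 * r)) ∧
    μ (Metric.ball x (2 * r)) ≤ ENNReal.ofReal Cd * μ (Metric.ball x r) ∧
    μ (Metric.ball x r) < ⊤
  poincare : ∀ (x : X) (r : ℝ), 0 < r → ∀ u : X → ℝ, MeasureTheory.LocallyIntegrable u μ →
    ∀ g : X → ℝ≥0∞, Measurable g → IsUpperGradientOn g u Set.univ →
      ∫⁻ y in Metric.ball x r, ENNReal.ofReal |u y - ⨍ z in Metric.ball x r, u z ∂μ| ∂μ ≤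
        ENNReal.ofReal (CP * r) * (μ (Metric.ball x r) / μ (Metric.ball x (lam * r))) *
          ∫⁻ y in Metric.ball x (lam * r), g y ∂μ


section Doubling

variable {μ : Measure X} {Cd CP lam : ℝ}

lemma MMS.ball_pos (h : MMS μ Cd CP lam) (x : X) {r : ℝ} (hr : 0 < r) : 0 < μ (ball x r) := by
  have := (h.doubling x (r / 2) (by positivity)).1
  rwa [mul_div_cancel₀ r two_ne_zero] at this

lemma MMS.ball_lt_top (h : MMS μ Cd CP lam) (x : X) (r : ℝ) : μ (ball x r) < ⊤ := by
  rcases le_or_gt r 0 with hr | hr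
  · simp [ball_eq_empty.2 hr]
  · exact (h.doubling x r hr).2.2

lemma MMS.ball_two_pow (h : MMS μ Cd CP lam) (x : X) {r : ℝ} (hr : 0 < r) (k : ℕ) :
    μ (ball x (2 ^ k * r)) ≤ ENNReal.ofReal Cd ^ k * μ (ball x r) := by
  induction k with
  | zero => simp
  | succ k ih =>
    calc μ (ball x (2 ^ (k + 1) * r)) = μ (ball x (2 * (2 ^ k * r))) := by ring_nf
      _ ≤ ENNReal.ofReal Cd * μ (ball x (2 ^ k * r)) := (h.doubling x _ (by positivity)).2.1
      _ ≤ ENNReal.ofReal Cd * (ENNReal.ofReal Cd ^ k * μ (ball x r)) := by gcongr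
      _ = _ := by ring

lemma MMS.ball_le_ball (h : MMS μ Cd CP lam) {x y : X} {r s : ℝ} (hs : 0 < s) (k : ℕ)
    (hk : r + dist x y ≤ 2 ^ k * s) :
    μ (ball x r) ≤ ENNReal.ofReal Cd ^ k * μ (ball y s) :=
  (measure_mono (ball_subset_ball' hk)).trans (h.ball_two_pow y hs k)

lemma MMS.one_le_ofReal_Cd (h : MMS μ Cd CP lam) : 1 ≤ ENNReal.ofReal Cd := by
  simpa using ENNReal.ofReal_le_ofReal h.hCd

lemma MMS.isLocallyFiniteMeasure (h : MMS μ Cd CP lam) : IsLocallyFiniteMeasure μ :=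
  ⟨fun x => ⟨ball x 1, ball_mem_nhds x one_pos, h.ball_lt_top x 1⟩⟩

lemma MMS.isUnifLocDoublingMeasure (h : MMS μ Cd CP lam) : IsUnifLocDoublingMeasure μ := by
  refine ⟨(Real.toNNReal Cd) ^ 2, ?_⟩
  filter_upwards [self_mem_nhdsWithin] with ε hε x
  have hε : 0 < ε := hε
  calc μ (closedBall x (2 * ε)) ≤ μ (ball x (2 ^ 2 * ε)) :=
        measure_mono (closedBall_subset_ball (by linarith))
    _ ≤ ENNReal.ofReal Cd ^ 2 * μ (ball x ε) := h.ball_two_pow x hε 2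
    _ ≤ _ := by
      rw [ENNReal.ofReal]
      push_cast
      gcongr
      exact ball_subset_closedBall

lemma MMS.properSpace [BorelSpace X] (h : MMS μ Cd CP lam) : ProperSpace X := by
  have := h.complete
  refine ⟨fun x r => TotallyBounded.isCompact_of_isClosed ?_ isClosed_closedBall⟩
  rw [Metric.totallyBounded_iff]
  by_contra! hcon
  obtain ⟨ε, hε, hcov⟩ := hcon
  have hr : 0 ≤ r := by
    by_contra! hr
    exact hcov ∅ finite_empty (by simp [closedBall_eq_empty.2 hr])
  obtain ⟨f, hf, hsep⟩ := exists_seq_of_forall_finset_exists (fun y => y ∈ closedBall x r)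
    (fun y z => ε ≤ dist z y) (by
      intro s _
      obtain ⟨z, hz, hz'⟩ := not_subset.1 (hcov s s.finite_toSet)
      refine ⟨z, hz, fun y hy => ?_⟩
      by_contra! hlt
      exact hz' (mem_biUnion hy hlt))
  have hdisj : Pairwise (Function.onFun Disjoint fun n => ball (f n) (ε / 2)) := by
    have key : ∀ m n, m < n → Disjoint (ball (f m) (ε / 2)) (ball (f n) (ε / 2)) := fun m n hmn =>
      ball_disjoint_ball (by have := hsep m n hmn; rw [dist_comm] at this; linarith)
    intro m n hmn
    rcases lt_or_gt_of_ne hmn with hlt | hlt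
    · exact key m n hlt
    · exact (key n m hlt).symm
  obtain ⟨k, hk⟩ := pow_unbounded_of_one_lt ((r + ε + r) / (ε / 2)) one_lt_two
  have hk' : r + ε + r ≤ 2 ^ k * (ε / 2) := by
    rw [div_lt_iff₀ (by positivity)] at hk
    exact hk.le
  have hlow : ∀ n, μ (ball x (r + ε)) ≤ ENNReal.ofReal Cd ^ k * μ (ball (f n) (ε / 2)) := fun n =>
    h.ball_le_ball (by positivity) k (by
      have := mem_closedBall'.1 (hf n)
      linarith)
  have hsum : ∑' n, μ (ball (f n) (ε / 2)) ≤ μ (ball x (r + ε)) := by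
    rw [← measure_iUnion hdisj fun n => measurableSet_ball]
    refine measure_mono (iUnion_subset fun n => ball_subset_ball' ?_)
    have := mem_closedBall.1 (hf n)
    linarith
  have htop : (⊤ : ℝ≥0∞) ≤ ENNReal.ofReal Cd ^ k * μ (ball x (r + ε)) := by
    calc (⊤ : ℝ≥0∞) = ∑' _ : ℕ, μ (ball x (r + ε)) :=
          (ENNReal.tsum_const_eq_top_of_ne_zero (h.ball_pos x (by positivity)).ne').symm
      _ ≤ ∑' n, ENNReal.ofReal Cd ^ k * μ (ball (f n) (ε / 2)) := ENNReal.tsum_le_tsum hlow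
      _ = ENNReal.ofReal Cd ^ k * ∑' n, μ (ball (f n) (ε / 2)) := ENNReal.tsum_mul_left
      _ ≤ _ := by gcongr
  exact (ENNReal.mul_lt_top (ENNReal.pow_lt_top ENNReal.ofReal_lt_top)
    (h.ball_lt_top x _)).not_ge htop

end Doubling

section BallAverages

variable {μ : Measure X}

lemma measurable_lintegral_ball [BorelSpace X] [SecondCountableTopology X] [SFinite μ]
    {g : X → ℝ≥0∞} (hg : Measurable g) (a : ℝ) :
    Measurable fun z => ∫⁻ y in ball z a, g y ∂μ := by
  have hS : MeasurableSet {p : X × X | dist p.2 p.1 < a} :=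
    measurableSet_lt (measurable_snd.dist measurable_fst) measurable_const
  have : Measurable fun p : X × X => {p : X × X | dist p.2 p.1 < a}.indicator (fun p => g p.2) p :=
    (hg.comp measurable_snd).indicator hS
  convert this.lintegral_prod_right' (ν := μ) using 2 with z
  rw [← lintegral_indicator measurableSet_ball]
  rfl

lemma measurable_measure_ball [BorelSpace X] [SecondCountableTopology X] [SFinite μ] (a : ℝ) :
    Measurable fun z => μ (ball z a) := by
  simpa using measurable_lintegral_ball (μ := μ) (g := fun _ => 1) measurable_const a

lemma lintegral_lintegral_ball_div [BorelSpace X] [SecondCountableTopology X] [SFinite μ]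
    {g : X → ℝ≥0∞} (hg : Measurable g) (a b : ℝ) :
    ∫⁻ z, (∫⁻ y in ball z a, g y ∂μ) / μ (ball z b) ∂μ =
      ∫⁻ y, g y * ∫⁻ z in ball y a, (μ (ball z b))⁻¹ ∂μ ∂μ := by
  have hm : Measurable fun z => (μ (ball z b))⁻¹ := (measurable_measure_ball b).inv
  have hS : MeasurableSet {p : X × X | dist p.2 p.1 < a} :=
    measurableSet_lt (measurable_snd.dist measurable_fst) measurable_const
  have hF : Measurable fun p : X × X =>
      {p : X × X | dist p.2 p.1 < a}.indicator (fun p => g p.2 * (μ (ball p.1 b))⁻¹) p :=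
    ((hg.comp measurable_snd).mul (hm.comp measurable_fst)).indicator hS
  calc ∫⁻ z, (∫⁻ y in ball z a, g y ∂μ) / μ (ball z b) ∂μ
      = ∫⁻ z, ∫⁻ y, {p : X × X | dist p.2 p.1 < a}.indicator
          (fun p => g p.2 * (μ (ball p.1 b))⁻¹) (z, y) ∂μ ∂μ := by
        refine lintegral_congr fun z => ?_
        rw [div_eq_mul_inv, ← lintegral_mul_const _ hg, ← lintegral_indicator measurableSet_ball]
        rfl
    _ = ∫⁻ y, ∫⁻ z, {p : X × X | dist p.2 p.1 < a}.indicator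
          (fun p => g p.2 * (μ (ball p.1 b))⁻¹) (z, y) ∂μ ∂μ :=
        lintegral_lintegral_swap hF.aemeasurable
    _ = _ := by
        refine lintegral_congr fun y => ?_
        rw [← lintegral_const_mul _ hm, ← lintegral_indicator measurableSet_ball]
        refine lintegral_congr fun z => ?_
        simp only [indicator, mem_ofPred_eq, mem_ball, dist_comm y z]

variable {Cd CP lam : ℝ}

lemma MMS.lintegral_ball_div_le [BorelSpace X] [SecondCountableTopology X] [SFinite μ]
    (h : MMS μ Cd CP lam) {g : X → ℝ≥0∞} (hg : Measurable g) {a b : ℝ} (hb : 0 < b) {k : ℕ}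
    (hk : 2 * a ≤ 2 ^ k * b) :
    ∫⁻ z, (∫⁻ y in ball z a, g y ∂μ) / μ (ball z b) ∂μ ≤
      ENNReal.ofReal Cd ^ k * ∫⁻ y, g y ∂μ := by
  rw [lintegral_lintegral_ball_div hg, ← lintegral_const_mul _ hg]
  refine lintegral_mono fun y => ?_
  rw [mul_comm]
  gcongr
  rcases le_or_gt a 0 with ha | ha
  · simp [ball_eq_empty.2 ha]
  calc ∫⁻ z in ball y a, (μ (ball z b))⁻¹ ∂μ
      ≤ ∫⁻ z in ball y a, ENNReal.ofReal Cd ^ k * (μ (ball y a))⁻¹ ∂μ := by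
        refine setLIntegral_mono measurable_const fun z hz => ?_
        have h1 : μ (ball y a) ≤ ENNReal.ofReal Cd ^ k * μ (ball z b) :=
          h.ball_le_ball hb k (by rw [mem_ball'] at hz; linarith)
        rw [← div_eq_mul_inv, ENNReal.le_div_iff_mul_le (Or.inl (h.ball_pos y ha).ne')
          (Or.inl (h.ball_lt_top y a).ne), mul_comm, ← div_eq_mul_inv]
        exact ENNReal.div_le_of_le_mul h1
    _ = ENNReal.ofReal Cd ^ k := by
        rw [setLIntegral_const, mul_assoc,
          ENNReal.inv_mul_cancel (h.ball_pos y ha).ne' (h.ball_lt_top y a).ne, mul_one]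

lemma MMS.measure_le_lintegral_ball_div [BorelSpace X] [SecondCountableTopology X] [SFinite μ]
    (h : MMS μ Cd CP lam) {F : Set X} (hF : MeasurableSet F) {s : ℝ} (hs : 0 < s) :
    μ F ≤ ENNReal.ofReal Cd * ∫⁻ z, μ (F ∩ ball z s) / μ (ball z s) ∂μ := by
  have h1 := lintegral_lintegral_ball_div (μ := μ) (g := F.indicator 1)
    (measurable_one.indicator hF) s s
  have h2 : ∀ z, ∫⁻ y in ball z s, F.indicator 1 y ∂μ = μ (F ∩ ball z s) := fun z => by
    rw [lintegral_indicator_one hF, Measure.restrict_apply hF]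
  simp only [h2] at h1
  rw [h1]
  have hm : Measurable fun y => ∫⁻ z in ball y s, (μ (ball z s))⁻¹ ∂μ :=
    measurable_lintegral_ball (measurable_measure_ball s).inv s
  rw [← lintegral_const_mul (f := fun y => F.indicator 1 y * ∫⁻ z in ball y s, (μ (ball z s))⁻¹ ∂μ)
    _ ((measurable_one.indicator hF).mul hm), ← lintegral_indicator_one hF]
  refine lintegral_mono fun y => ?_
  by_cases hy : y ∈ F
  swap
  · simp [hy]
  simp only [indicator_of_mem hy, Pi.one_apply, one_mul]
  have hpos := (h.ball_pos y hs).ne'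
  have hfin := (h.ball_lt_top y s).ne
  calc (1 : ℝ≥0∞) = ∫⁻ z in ball y s, (μ (ball y s))⁻¹ ∂μ := by
        rw [setLIntegral_const, ENNReal.inv_mul_cancel hpos hfin]
    _ ≤ ∫⁻ z in ball y s, ENNReal.ofReal Cd * (μ (ball z s))⁻¹ ∂μ := by
        refine setLIntegral_mono ((measurable_measure_ball s).inv.const_mul _) fun z hz => ?_
        have h1 : μ (ball z s) ≤ ENNReal.ofReal Cd * μ (ball y s) := by
          simpa using h.ball_le_ball hs 1 (x := z) (r := s) (by rw [mem_ball] at hz; linarith)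
        rw [← div_eq_mul_inv, ENNReal.le_div_iff_mul_le (Or.inl (h.ball_pos z hs).ne')
          (Or.inl (h.ball_lt_top z s).ne), mul_comm, ← div_eq_mul_inv]
        exact ENNReal.div_le_of_le_mul h1
    _ = _ := lintegral_const_mul _ (measurable_measure_ball s).inv

end BallAverages

section Curves

omit [MeasurableSpace X] in
lemma ofReal_abs_deriv_comp_le_mul_speed {γ : ℝ → X} {v : X → ℝ} {t : ℝ} {L : ℝ≥0}
    (hγ : ContinuousAt γ t)
    (hv : ∀ᶠ z in 𝓝 (γ t), |v z - v (γ t)| ≤ L * dist z (γ t))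
    (hd : DifferentiableAt ℝ (fun τ => v (γ τ)) t) :
    ENNReal.ofReal |deriv (fun τ => v (γ τ)) t| ≤ L * speed γ t := by
  have h1 : Tendsto (fun h : ℝ => ENNReal.ofReal |h⁻¹ • (v (γ (t + h)) - v (γ t))|) (𝓝[≠] 0)
      (𝓝 (ENNReal.ofReal |deriv (fun τ => v (γ τ)) t|)) :=
    ENNReal.tendsto_ofReal (hd.hasDerivAt.tendsto_slope_zero.abs)
  have h2 : Tendsto (fun h : ℝ => γ (t + h)) (𝓝[≠] 0) (𝓝 (γ t)) := by
    have : Tendsto (fun h : ℝ => t + h) (𝓝[≠] 0) (𝓝 t) := by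
      have h0 : Tendsto (fun h : ℝ => t + h) (𝓝 0) (𝓝 (t + 0)) := tendsto_const_nhds.add tendsto_id
      rw [add_zero] at h0
      exact h0.mono_left nhdsWithin_le_nhds
    exact hγ.tendsto.comp this
  rw [← h1.limsup_eq, speed, ← ENNReal.limsup_const_mul_of_ne_top ENNReal.coe_ne_top]
  refine limsup_le_limsup ?_
  filter_upwards [h2.eventually hv] with h hh
  rw [← ENNReal.ofReal_coe_nnreal, ← ENNReal.ofReal_mul (NNReal.coe_nonneg L), smul_eq_mul, abs_mul, abs_inv]
  apply ENNReal.ofReal_le_ofReal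
  calc |h|⁻¹ * |v (γ (t + h)) - v (γ t)| ≤ |h|⁻¹ * (L * dist (γ (t + h)) (γ t)) := by gcongr
    _ = _ := by rw [div_eq_mul_inv]; ring

omit [MeasurableSpace X] in
lemma speed_comp_affine_le (γ : ℝ → X) (s c τ : ℝ) (hc : 0 < c) :
    speed (fun σ => γ (s + c * σ)) τ ≤ ENNReal.ofReal c * speed γ (s + c * τ) := by
  have hmap : Tendsto (fun h : ℝ => c * h) (𝓝[≠] 0) (𝓝[≠] 0) := by
    refine tendsto_nhdsWithin_iff.2 ⟨?_, ?_⟩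
    · have h0 : Tendsto (fun h : ℝ => c * h) (𝓝 0) (𝓝 (c * 0)) :=
        tendsto_const_nhds.mul tendsto_id
      rw [mul_zero] at h0
      exact h0.mono_left nhdsWithin_le_nhds
    · filter_upwards [self_mem_nhdsWithin] with h hh
      exact mul_ne_zero hc.ne' hh
  calc speed (fun σ => γ (s + c * σ)) τ
      = limsup (fun h : ℝ => ENNReal.ofReal c * (fun k : ℝ =>
          ENNReal.ofReal (dist (γ (s + c * τ + k)) (γ (s + c * τ)) / |k|)) (c * h)) (𝓝[≠] 0) := by
        refine limsup_congr ?_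
        filter_upwards [self_mem_nhdsWithin] with h hh
        have hh : h ≠ 0 := hh
        rw [← ENNReal.ofReal_mul hc.le, abs_mul, abs_of_pos hc,
          show s + c * (τ + h) = s + c * τ + c * h by ring]
        congr 1
        have : |h| ≠ 0 := abs_ne_zero.2 hh
        field_simp
    _ = ENNReal.ofReal c * limsup ((fun k : ℝ =>
          ENNReal.ofReal (dist (γ (s + c * τ + k)) (γ (s + c * τ)) / |k|)) ∘ (fun h => c * h))
          (𝓝[≠] 0) := ENNReal.limsup_const_mul_of_ne_top ENNReal.ofReal_ne_top
    _ ≤ _ := by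
        rw [limsup_comp]
        gcongr
        exact limsup_le_limsup_of_le hmap

omit [MeasurableSpace X] in
lemma IsUpperGradientOn.le_lintegral_Icc {G : X → ℝ≥0∞} {v : X → ℝ}
    (hG : IsUpperGradientOn G v univ) (γ : Curve X) {s t : ℝ} (hs : 0 ≤ s) (hst : s ≤ t)
    (ht : t ≤ 1) :
    ENNReal.ofReal |v (γ.toFun t) - v (γ.toFun s)| ≤
      ∫⁻ τ in Icc s t, G (γ.toFun τ) * speed γ.toFun τ := by
  rcases hst.eq_or_lt with rfl | hst
  · simp
  have hc : 0 < t - s := sub_pos.2 hst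
  have himg : (fun σ : ℝ => s + (t - s) * σ) '' Icc 0 1 = Icc s t := by
    simpa [add_comm] using image_affine_Icc' hc s 0 1
  have hmaps : MapsTo (fun σ : ℝ => s + (t - s) * σ) (Icc 0 1) (Icc 0 1) := fun σ hσ => by
    have : s + (t - s) * σ ∈ Icc s t := himg ▸ mem_image_of_mem _ hσ
    exact ⟨hs.trans this.1, this.2.trans ht⟩
  have hlip : ∃ K : ℝ≥0, LipschitzOnWith K (fun σ => γ.toFun (s + (t - s) * σ)) (Icc 0 1) := by
    obtain ⟨K, hK⟩ := γ.lipschitz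
    have hL : LipschitzOnWith (Real.toNNReal (t - s)) (fun σ : ℝ => s + (t - s) * σ) (Icc 0 1) := by
      refine LipschitzOnWith.of_dist_le_mul fun a _ b _ => ?_
      rw [Real.dist_eq, Real.dist_eq, Real.coe_toNNReal _ hc.le,
        show s + (t - s) * a - (s + (t - s) * b) = (t - s) * (a - b) by ring, abs_mul,
        abs_of_pos hc]
    exact ⟨_, hK.comp hL hmaps⟩
  have key := hG ⟨fun σ => γ.toFun (s + (t - s) * σ), hlip⟩ fun _ _ => mem_univ _
  simp only [mul_one, mul_zero, add_zero, add_sub_cancel, curveIntegral] at key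
  refine key.trans ?_
  rw [← himg, lintegral_image_eq_lintegral_abs_deriv_mul (f' := fun _ => t - s) measurableSet_Icc
    (fun x _ => by
      simpa using (((hasDerivAt_id x).const_mul (t - s)).const_add s).hasDerivWithinAt)
    (fun a _ b _ hab => by simpa [hc.ne'] using hab)]
  refine lintegral_mono fun τ => ?_
  rw [abs_of_pos hc]
  calc _ ≤ G (γ.toFun (s + (t - s) * τ)) *
        (ENNReal.ofReal (t - s) * speed γ.toFun (s + (t - s) * τ)) := by
        gcongr
        exact speed_comp_affine_le γ.toFun s (t - s) τ hc
    _ = _ := by ring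

lemma ae_deriv_le_of_le_lintegral {f : ℝ → ℝ} {H : ℝ → ℝ≥0∞}
    (hH : ∫⁻ τ in Icc (0 : ℝ) 1, H τ ≠ ⊤)
    (hf : ∀ s t, 0 ≤ s → s ≤ t → t ≤ 1 → ENNReal.ofReal |f t - f s| ≤ ∫⁻ τ in Icc s t, H τ) :
    ∀ᵐ t, t ∈ Icc (0 : ℝ) 1 → DifferentiableAt ℝ f t → ENNReal.ofReal |deriv f t| ≤ H t := by
  obtain ⟨h, hm, hle, hset⟩ := exists_measurable_le_setLIntegral_eq_of_integrable hH
  have hsub : ∀ s t, 0 ≤ s → t ≤ 1 → ∫⁻ τ in Icc s t, H τ = ∫⁻ τ in Icc s t, h τ := by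
    intro s t hs ht
    have := hset (Icc s t) measurableSet_Icc
    rwa [Measure.restrict_restrict measurableSet_Icc,
      inter_eq_left.2 (Icc_subset_Icc hs ht)] at this
  have hfin : ∫⁻ τ in Icc (0 : ℝ) 1, h τ ≠ ⊤ := by rwa [← hsub 0 1 le_rfl le_rfl]
  have hae : ∀ᵐ t, t ∈ Icc (0 : ℝ) 1 → h t < ⊤ :=
    (ae_restrict_iff' measurableSet_Icc).1 (ae_lt_top hm hfin)
  have hI : IntervalIntegrable (fun τ => (h τ).toReal) volume 0 1 := by
    rw [intervalIntegrable_iff_integrableOn_Icc_of_le zero_le_one]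
    exact integrable_toReal_of_lintegral_ne_top hm.aemeasurable hfin
  have hbound : ∀ s t, 0 ≤ s → s ≤ t → t ≤ 1 → |f t - f s| ≤ ∫ τ in s..t, (h τ).toReal := by
    intro s t hs hst ht
    have h1 := hf s t hs hst ht
    rw [hsub s t hs ht] at h1
    have hfin' : ∫⁻ τ in Icc s t, h τ ≠ ⊤ :=
      ne_top_of_le_ne_top hfin (lintegral_mono_set (Icc_subset_Icc hs ht))
    rw [intervalIntegral.integral_of_le hst, ← integral_Icc_eq_integral_Ioc,
      integral_toReal hm.aemeasurable (ae_lt_top hm hfin')]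
    exact (ENNReal.ofReal_le_iff_le_toReal hfin').1 h1
  have h0 : ∀ᵐ x : ℝ, x ≠ 0 := by simp [ae_iff, measure_singleton]
  have h1 : ∀ᵐ x : ℝ, x ≠ 1 := by simp [ae_iff, measure_singleton]
  filter_upwards [hae, hI.ae_hasDerivAt_integral, h0, h1] with t htop hder ht0 ht1 ht hd
  have hI' : ∀ a b, a ∈ Icc (0 : ℝ) 1 → b ∈ Icc (0 : ℝ) 1 →
      IntervalIntegrable (fun τ => (h τ).toReal) volume a b := fun a b ha hb =>
    hI.mono_set (by rw [uIcc_of_le zero_le_one]; exact uIcc_subset_Icc ha hb)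
  have hD := hder (by rwa [uIcc_of_le zero_le_one]) 0 (by simp)
  have hnear : ∀ᶠ σ in 𝓝[≠] t, σ ∈ Icc (0 : ℝ) 1 :=
    nhdsWithin_le_nhds (Icc_mem_nhds (lt_of_le_of_ne ht.1 ht0.symm) (lt_of_le_of_ne ht.2 ht1))
  have hlim : |deriv f t| ≤ |(h t).toReal| := by
    refine le_of_tendsto_of_tendsto (hd.hasDerivAt.tendsto_slope.abs) hD.tendsto_slope.abs ?_
    filter_upwards [hnear] with σ hσ
    rw [slope_def_field, slope_def_field, abs_div, abs_div]
    refine div_le_div_of_nonneg_right ?_ (abs_nonneg _)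
    rw [intervalIntegral.integral_interval_sub_left (hI' 0 σ (by simp) hσ) (hI' 0 t (by simp) ht)]
    rcases le_total t σ with hle' | hle'
    · exact (hbound t σ ht.1 hle' hσ.2).trans (le_abs_self _)
    · rw [abs_sub_comm, intervalIntegral.integral_symm, abs_neg]
      exact (hbound σ t hσ.1 hle' ht.2).trans (le_abs_self _)
  calc ENNReal.ofReal |deriv f t| ≤ ENNReal.ofReal |(h t).toReal| := ENNReal.ofReal_le_ofReal hlim
    _ = h t := by rw [abs_of_nonneg ENNReal.toReal_nonneg, ENNReal.ofReal_toReal (htop ht).ne]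
    _ ≤ H t := hle t

lemma ofReal_abs_sub_le_lintegral {f : ℝ → ℝ} {K : ℝ≥0} (hf : LipschitzOnWith K f (Icc 0 1))
    {H : ℝ → ℝ≥0∞}
    (hH : ∀ᵐ t, t ∈ Icc (0 : ℝ) 1 → DifferentiableAt ℝ f t → ENNReal.ofReal |deriv f t| ≤ H t) :
    ENNReal.ofReal |f 1 - f 0| ≤ ∫⁻ t in Icc (0 : ℝ) 1, H t := by
  have hac : AbsolutelyContinuousOnInterval f 0 1 :=
    LipschitzOnWith.absolutelyContinuousOnInterval (K := K) (by rwa [uIcc_of_le zero_le_one])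
  rw [← hac.integral_deriv_eq_sub, intervalIntegral.integral_of_le zero_le_one,
    ← integral_Icc_eq_integral_Ioc, ← Real.norm_eq_abs, ofReal_norm]
  refine (enorm_integral_le_lintegral_enorm _).trans (lintegral_mono_ae ?_)
  rw [ae_restrict_iff' measurableSet_Icc]
  filter_upwards [hH, hac.ae_differentiableAt] with t ht hdt htI
  rw [← ofReal_norm, Real.norm_eq_abs]
  exact ht htI (hdt (by rwa [uIcc_of_le zero_le_one]))

omit [MeasurableSpace X] in
lemma Curve.continuousAt (γ : Curve X) {t : ℝ} (ht : t ∈ Ioo (0 : ℝ) 1) :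
    ContinuousAt γ.toFun t := by
  obtain ⟨K, hK⟩ := γ.lipschitz
  exact hK.continuousOn.continuousAt (Icc_mem_nhds ht.1 ht.2)

omit [MeasurableSpace X] in
lemma LocLipschitzOn.exists_lipschitzOnWith_comp {v : X → ℝ} (hv : LocLipschitzOn v univ)
    (γ : Curve X) : ∃ K : ℝ≥0, LipschitzOnWith K (fun t => v (γ.toFun t)) (Icc 0 1) := by
  obtain ⟨K, hK⟩ := γ.lipschitz
  obtain ⟨L, hL⟩ := hv (γ.toFun '' Icc 0 1) (isCompact_Icc.image_of_continuousOn hK.continuousOn)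
    (subset_univ _)
  exact ⟨L * K, hL.comp hK (mapsTo_image _ _)⟩

lemma ae_mem_Ioo_of_mem_Icc : ∀ᵐ t : ℝ, t ∈ Icc (0 : ℝ) 1 → t ∈ Ioo (0 : ℝ) 1 := by
  have h0 : ∀ᵐ x : ℝ, x ≠ 0 := by simp [ae_iff, measure_singleton]
  have h1 : ∀ᵐ x : ℝ, x ≠ 1 := by simp [ae_iff, measure_singleton]
  filter_upwards [h0, h1] with t ht0 ht1 ht
  exact ⟨lt_of_le_of_ne ht.1 ht0.symm, lt_of_le_of_ne ht.2 ht1⟩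

omit [MeasurableSpace X] in
/-- A pointwise Lipschitz bound at all points is an upper gradient. -/
lemma LocLipschitzOn.isUpperGradientOn {v : X → ℝ} (hv : LocLipschitzOn v univ) {L : X → ℝ≥0}
    (hL : ∀ z, ∀ᶠ z' in 𝓝 z, |v z' - v z| ≤ L z * dist z' z) :
    IsUpperGradientOn (fun z => (L z : ℝ≥0∞)) v univ := by
  intro γ _
  obtain ⟨K, hK⟩ := hv.exists_lipschitzOnWith_comp γ
  refine ofReal_abs_sub_le_lintegral hK ?_
  filter_upwards [ae_mem_Ioo_of_mem_Icc] with t ht htI hd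
  exact ofReal_abs_deriv_comp_le_mul_speed (γ.continuousAt (ht htI)) (hL _) hd

variable {μ : Measure X}

lemma mod1_le {Γ : Set (Curve X)} {ρ : X → ℝ≥0∞} (hρ : Measurable ρ)
    (hΓ : ∀ γ ∈ Γ, 1 ≤ curveIntegral ρ γ) : Mod1 μ Γ ≤ ∫⁻ x, ρ x ∂μ :=
  iInf_le_of_le ρ <| iInf_le_of_le hρ <| iInf_le_of_le hΓ le_rfl

lemma mod1_setOf_curveIntegral_eq_top {G : X → ℝ≥0∞} (hG : Measurable G)
    (hfin : ∫⁻ x, G x ∂μ ≠ ⊤) : Mod1 μ {γ | curveIntegral G γ = ⊤} = 0 := by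
  refine le_antisymm (ENNReal.le_of_forall_pos_le_add fun ε hε _ => ?_) bot_le
  set I := ∫⁻ x, G x ∂μ
  have hIne : I + 1 ≠ ⊤ := by simp [hfin]
  have hI0 : I + 1 ≠ 0 := by simp
  have hδ : (ε : ℝ≥0∞) / (I + 1) ≠ 0 := by
    simp [ENNReal.div_eq_zero_iff, hε.ne', hfin]
  have hδ' : (ε : ℝ≥0∞) / (I + 1) ≠ ⊤ := ENNReal.div_ne_top ENNReal.coe_ne_top hI0
  rw [zero_add]
  refine (mod1_le (hG.const_mul ((ε : ℝ≥0∞) / (I + 1))) ?_).trans ?_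
  · intro γ hγ
    have : curveIntegral (fun x => (ε : ℝ≥0∞) / (I + 1) * G x) γ = ⊤ := by
      unfold curveIntegral
      simp only [mul_assoc]
      rw [lintegral_const_mul' _ _ hδ']
      rw [mem_ofPred_eq, curveIntegral] at hγ
      rw [hγ, ENNReal.mul_top hδ]
    rw [this]
    exact le_top
  · rw [lintegral_const_mul _ hG]
    calc (ε : ℝ≥0∞) / (I + 1) * I ≤ ε / (I + 1) * (I + 1) := by gcongr; exact le_self_add
      _ = ε := ENNReal.div_mul_cancel hI0 hIne

omit [MeasurableSpace X] in
lemma sum_curveIntegral_le (ρ : ℕ → X → ℝ≥0∞) (γ : Curve X) (n : ℕ) :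
    ∑ k ∈ Finset.range n, curveIntegral (ρ k) γ ≤ curveIntegral (fun x => ∑' k, ρ k x) γ := by
  have h1 : ∑ k ∈ Finset.range n, curveIntegral (ρ k) γ ≤
      curveIntegral (fun x => ∑ k ∈ Finset.range n, ρ k x) γ := by
    induction n with
    | zero => simp
    | succ n ih =>
      rw [Finset.sum_range_succ]
      refine (add_le_add_left ih _).trans ((le_lintegral_add _ _).trans (lintegral_mono fun t => ?_))
      simp only [Finset.sum_range_succ, add_mul]
      exact le_rfl
  refine h1.trans (lintegral_mono fun t => ?_)
  gcongr
  exact ENNReal.sum_le_tsum _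

lemma exists_curveIntegral_eq_top {Γ : Set (Curve X)} (hΓ : Mod1 μ Γ = 0) {ε : ℝ≥0∞}
    (hε : ε ≠ 0) : ∃ ρ : X → ℝ≥0∞, Measurable ρ ∧ ∫⁻ x, ρ x ∂μ ≤ ε ∧
      ∀ γ ∈ Γ, curveIntegral ρ γ = ⊤ := by
  obtain ⟨δ, hδ, hsum⟩ := ENNReal.exists_pos_sum_of_countable' hε ℕ
  have hex : ∀ k, ∃ ρ : X → ℝ≥0∞, Measurable ρ ∧ (∀ γ ∈ Γ, 1 ≤ curveIntegral ρ γ) ∧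
      ∫⁻ x, ρ x ∂μ < δ k := by
    intro k
    have : Mod1 μ Γ < δ k := by rw [hΓ]; exact hδ k
    simpa only [Mod1, iInf_lt_iff, exists_prop] using this
  choose ρ hm hadm hlt using hex
  refine ⟨fun x => ∑' k, ρ k x, Measurable.tsum hm, ?_, fun γ hγ => ?_⟩
  · rw [lintegral_tsum fun k => (hm k).aemeasurable]
    exact (ENNReal.tsum_le_tsum fun k => (hlt k).le).trans hsum.le
  · refine ENNReal.eq_top_of_forall_nnreal_le fun r => ?_
    obtain ⟨n, hn⟩ := exists_nat_ge r
    calc (r : ℝ≥0∞) ≤ n := by exact_mod_cast hn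
      _ = ∑ k ∈ Finset.range n, (1 : ℝ≥0∞) := by simp
      _ ≤ ∑ k ∈ Finset.range n, curveIntegral (ρ k) γ := by
        gcongr with k _
        exact hadm k γ hγ
      _ ≤ _ := sum_curveIntegral_le ρ γ n

lemma IsWeakUpperGradientOn.exists_isUpperGradientOn {G : X → ℝ≥0∞} {v : X → ℝ} {Ω : Set X}
    (hv : IsWeakUpperGradientOn μ G v Ω) (hG : Measurable G) {ε : ℝ≥0∞} (hε : ε ≠ 0) :
    ∃ G' : X → ℝ≥0∞, Measurable G' ∧ IsUpperGradientOn G' v Ω ∧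
      ∫⁻ x, G' x ∂μ ≤ ∫⁻ x, G x ∂μ + ε := by
  obtain ⟨Γ, hΓ, hug⟩ := hv
  obtain ⟨ρ, hρ, hle, htop⟩ := exists_curveIntegral_eq_top hΓ hε
  refine ⟨fun x => G x + ρ x, hG.add hρ, fun γ hγ => ?_, ?_⟩
  · by_cases hmem : γ ∈ Γ
    · have : curveIntegral ρ γ ≤ curveIntegral (fun x => G x + ρ x) γ :=
        lintegral_mono fun t => by gcongr; exact le_add_self
      rw [htop γ hmem] at this
      exact le_top.trans this
    · exact (hug γ hmem hγ).trans (lintegral_mono fun t => by gcongr; exact le_self_add)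
  · rw [lintegral_add_left hG]
    gcongr

lemma IsUpperGradientOn.isWeakUpperGradientOn {G : X → ℝ≥0∞} {v : X → ℝ} {Ω : Set X}
    (hG : IsUpperGradientOn G v Ω) : IsWeakUpperGradientOn μ G v Ω := by
  refine ⟨∅, le_antisymm ?_ bot_le, fun γ _ hγ => hG γ hγ⟩
  simpa using mod1_le (μ := μ) (Γ := ∅) measurable_zero (by simp)

/-- The Leibniz rule for the product of a locally Lipschitz function and a Lipschitz cutoff that is
locally constant off `S`. -/
lemma IsUpperGradientOn.mul_cutoff {G : X → ℝ≥0∞} {v a : X → ℝ} {S : Set X} {L : ℝ≥0}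
    (hG : IsUpperGradientOn G v univ) (hGm : Measurable G) (hfin : ∫⁻ x, G x ∂μ ≠ ⊤)
    (hv : LocLipschitzOn v univ) (ha : LipschitzWith L a) (ha0 : ∀ z, 0 ≤ a z)
    (haS : ∀ z ∉ S, ∀ᶠ z' in 𝓝 z, a z' = a z) :
    IsWeakUpperGradientOn μ
      (fun z => ENNReal.ofReal (a z) * G z + S.indicator (fun z => L * ENNReal.ofReal |v z|) z)
      (fun z => a z * v z) univ := by
  refine ⟨{γ | curveIntegral G γ = ⊤}, mod1_setOf_curveIntegral_eq_top hGm hfin, fun γ hγ _ => ?_⟩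
  obtain ⟨K, hK⟩ := hv.exists_lipschitzOnWith_comp γ
  obtain ⟨Kγ, hKγ⟩ := γ.lipschitz
  have haγ : LipschitzOnWith (L * Kγ) (fun t => a (γ.toFun t)) (Icc 0 1) :=
    (ha.lipschitzOnWith (s := univ)).comp hKγ (mapsTo_univ _ _)
  have hacv : AbsolutelyContinuousOnInterval (fun t => v (γ.toFun t)) 0 1 :=
    LipschitzOnWith.absolutelyContinuousOnInterval (K := K) (by rwa [uIcc_of_le zero_le_one])
  have haca : AbsolutelyContinuousOnInterval (fun t => a (γ.toFun t)) 0 1 :=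
    LipschitzOnWith.absolutelyContinuousOnInterval (K := L * Kγ) (by rwa [uIcc_of_le zero_le_one])
  have hder := ae_deriv_le_of_le_lintegral (f := fun t => v (γ.toFun t))
    (H := fun t => G (γ.toFun t) * speed γ.toFun t) hγ
    fun s t hs hst ht => hG.le_lintegral_Icc γ hs hst ht
  have hac := haca.mul hacv
  have hprod : ∀ᵐ t, t ∈ Icc (0 : ℝ) 1 →
      ENNReal.ofReal |deriv (fun t => a (γ.toFun t) * v (γ.toFun t)) t| ≤
        (ENNReal.ofReal (a (γ.toFun t)) * G (γ.toFun t) +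
          S.indicator (fun z => L * ENNReal.ofReal |v z|) (γ.toFun t)) * speed γ.toFun t := by
    filter_upwards [ae_mem_Ioo_of_mem_Icc, hder, hacv.ae_differentiableAt,
      haca.ae_differentiableAt] with t ht1 ht2 ht3 ht4 ht
    have hdv := ht3 (by rwa [uIcc_of_le zero_le_one])
    have hda := ht4 (by rwa [uIcc_of_le zero_le_one])
    have hderv := ht2 ht hdv
    have hdera : ENNReal.ofReal |deriv (fun t => a (γ.toFun t)) t| * ENNReal.ofReal |v (γ.toFun t)| ≤
        S.indicator (fun z => L * ENNReal.ofReal |v z|) (γ.toFun t) * speed γ.toFun t := by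
      by_cases hS : γ.toFun t ∈ S
      · rw [indicator_of_mem hS, mul_right_comm]
        gcongr
        refine ofReal_abs_deriv_comp_le_mul_speed (γ.continuousAt (ht1 ht))
          (Eventually.of_forall fun z => ?_) hda
        simpa [Real.dist_eq] using ha.dist_le_mul z (γ.toFun t)
      · have : deriv (fun t => a (γ.toFun t)) t = 0 := by
          have hev : (fun t => a (γ.toFun t)) =ᶠ[𝓝 t] fun _ => a (γ.toFun t) :=
            (γ.continuousAt (ht1 ht)).eventually (haS _ hS)
          rw [hev.deriv_eq, deriv_const]
        simp [this]
    rw [deriv_fun_mul hda hdv]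
    calc ENNReal.ofReal |deriv (fun t => a (γ.toFun t)) t * v (γ.toFun t) +
          a (γ.toFun t) * deriv (fun t => v (γ.toFun t)) t|
        ≤ ENNReal.ofReal (|deriv (fun t => a (γ.toFun t)) t| * |v (γ.toFun t)| +
          a (γ.toFun t) * |deriv (fun t => v (γ.toFun t)) t|) := by
          apply ENNReal.ofReal_le_ofReal
          refine (abs_add_le _ _).trans ?_
          rw [abs_mul, abs_mul, abs_of_nonneg (ha0 _)]
      _ = ENNReal.ofReal |deriv (fun t => a (γ.toFun t)) t| * ENNReal.ofReal |v (γ.toFun t)| +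
          ENNReal.ofReal (a (γ.toFun t)) *
            ENNReal.ofReal |deriv (fun t => v (γ.toFun t)) t| := by
          rw [ENNReal.ofReal_add (by positivity) (mul_nonneg (ha0 _) (abs_nonneg _)),
            ENNReal.ofReal_mul (abs_nonneg _), ENNReal.ofReal_mul (ha0 _)]
      _ ≤ S.indicator (fun z => L * ENNReal.ofReal |v z|) (γ.toFun t) * speed γ.toFun t +
          ENNReal.ofReal (a (γ.toFun t)) * (G (γ.toFun t) * speed γ.toFun t) := by gcongr
      _ = _ := by ring
  rw [curveIntegral]
  have hI := hac.integral_deriv_eq_sub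
  simp only [Pi.mul_apply] at hI
  rw [← hI, intervalIntegral.integral_of_le zero_le_one,
    ← integral_Icc_eq_integral_Ioc, ← Real.norm_eq_abs, ofReal_norm]
  refine (enorm_integral_le_lintegral_enorm _).trans (lintegral_mono_ae ?_)
  rw [ae_restrict_iff' measurableSet_Icc]
  filter_upwards [hprod] with t ht htI
  rw [← ofReal_norm, Real.norm_eq_abs]
  exact ht htI

end Curves

section TotalVariation

variable {μ : Measure X} {u u' : X → ℝ} {v : ℕ → X → ℝ}

lemma TendstoL1Loc.congr_ae {Ω : Set X} (h : TendstoL1Loc μ v u Ω) (hu : u =ᵐ[μ] u') :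
    TendstoL1Loc μ v u' Ω := by
  intro K hK hKΩ
  refine (h K hK hKΩ).congr fun i => lintegral_congr_ae ?_
  filter_upwards [ae_restrict_of_ae hu] with x hx
  rw [hx]

lemma tv_congr_ae (hu : u =ᵐ[μ] u') (Ω : Set X) : tv μ u Ω = tv μ u' Ω := by
  have key : ∀ {u u' : X → ℝ}, u =ᵐ[μ] u' → tv μ u Ω ≤ tv μ u' Ω := fun {u u'} hu => by
    refine iInf_mono fun v => iInf_mono fun hv => ?_
    exact le_iInf fun hv' => iInf_le_of_le (hv'.congr_ae hu.symm) le_rfl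
  exact le_antisymm (key hu) (key hu.symm)

lemma tv_le_liminf {Ω : Set X} (hv : ∀ i, LocLipschitzOn (v i) Ω) (hvu : TendstoL1Loc μ v u Ω)
    {g : ℕ → X → ℝ≥0∞} (hg : ∀ i, Measurable (g i))
    (hgv : ∀ i, IsWeakUpperGradientOn μ (g i) (v i) Ω) :
    tv μ u Ω ≤ liminf (fun i => ∫⁻ x in Ω, g i x ∂μ) atTop :=
  iInf_le_of_le v <| iInf_le_of_le hv <| iInf_le_of_le hvu <| iInf_le_of_le g <|
    iInf_le_of_le hg <| iInf_le_of_le hgv le_rfl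

/-- Locally Lipschitz functions converging to `u` in `L¹_loc` with upper gradients of integral at
most `c`. -/
structure Approximates (μ : Measure X) (v : ℕ → X → ℝ) (G : ℕ → X → ℝ≥0∞) (u : X → ℝ)
    (c : ℝ≥0∞) : Prop where
  locLipschitz : ∀ i, LocLipschitzOn (v i) univ
  tendsto : TendstoL1Loc μ v u univ
  measurable : ∀ i, Measurable (G i)
  isUpperGradientOn : ∀ i, IsUpperGradientOn (G i) (v i) univ
  lintegral_le : ∀ i, ∫⁻ x, G i x ∂μ ≤ c

lemma exists_approximates_of_tv_lt {c : ℝ≥0∞} (h : tv μ u univ < c) :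
    ∃ (v : ℕ → X → ℝ) (G : ℕ → X → ℝ≥0∞), Approximates μ v G u c := by
  simp only [tv, iInf_lt_iff, exists_prop, setLIntegral_univ] at h
  obtain ⟨v, hv, hvu, g, hg, hgv, hlt⟩ := h
  obtain ⟨φ, hφ, hφlt⟩ := extraction_of_frequently_atTop 
    (frequently_lt_of_liminf_lt (by isBoundedDefault) hlt)
  have hex : ∀ i, ∃ G' : X → ℝ≥0∞, Measurable G' ∧ IsUpperGradientOn G' (v (φ i)) univ ∧
      ∫⁻ x, G' x ∂μ ≤ c := fun i => by
    obtain ⟨G', h1, h2, h3⟩ := (hgv (φ i)).exists_isUpperGradientOn (hg _)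
      (tsub_pos_of_lt (hφlt i)).ne'
    exact ⟨G', h1, h2, h3.trans_eq (add_tsub_cancel_of_le (hφlt i).le)⟩
  choose G hG1 hG2 hG3 using hex
  exact ⟨fun i => v (φ i), G, fun i => hv _, fun K hK hKΩ => (hvu K hK hKΩ).comp hφ.tendsto_atTop,
    hG1, hG2, hG3⟩

lemma TendstoL1Loc.eventually_lintegral_abs_le (h : TendstoL1Loc μ v u univ)
    (hu : AEMeasurable u μ) {K : Set X} (hK : IsCompact K) {ε : ℝ≥0∞} (hε : ε ≠ 0) :
    ∀ᶠ i in atTop, ∫⁻ x in K, ENNReal.ofReal |v i x| ∂μ ≤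
      ∫⁻ x in K, ENNReal.ofReal |u x| ∂μ + ε := by
  filter_upwards [(h K hK (subset_univ _)).eventually_lt_const (pos_iff_ne_zero.2 hε)] with i hi
  have hm : AEMeasurable (fun x => ENNReal.ofReal |u x|) (μ.restrict K) :=
    ((measurable_id.abs.comp_aemeasurable hu).ennreal_ofReal).restrict
  calc ∫⁻ x in K, ENNReal.ofReal |v i x| ∂μ
      ≤ ∫⁻ x in K, (ENNReal.ofReal |u x| + ENNReal.ofReal |v i x - u x|) ∂μ := by
        refine lintegral_mono fun x => ?_
        rw [← ENNReal.ofReal_add (abs_nonneg _) (abs_nonneg _)]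
        apply ENNReal.ofReal_le_ofReal
        calc |v i x| = |u x + (v i x - u x)| := by ring_nf
          _ ≤ _ := abs_add_le _ _
    _ = ∫⁻ x in K, ENNReal.ofReal |u x| ∂μ + ∫⁻ x in K, ENNReal.ofReal |v i x - u x| ∂μ :=
        lintegral_add_left' hm _
    _ ≤ _ := by gcongr

lemma TendstoL1Loc.mul_cutoff {a : X → ℝ} (h : TendstoL1Loc μ v u univ) (ha : ∀ z, |a z| ≤ 1) :
    TendstoL1Loc μ (fun i z => a z * v i z) (fun z => a z * u z) univ := by
  intro K hK hKu
  refine tendsto_of_tendsto_of_tendsto_of_le_of_le tendsto_const_nhds (h K hK hKu)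
    (fun i => bot_le) fun i => lintegral_mono fun z => ENNReal.ofReal_le_ofReal ?_
  simp only
  rw [← mul_sub, abs_mul]
  exact mul_le_of_le_one_left (abs_nonneg _) (ha z)

omit [MeasurableSpace X] in
lemma LocLipschitzOn.continuous [ProperSpace X] {w : X → ℝ} (hw : LocLipschitzOn w univ) :
    Continuous w := by
  refine continuous_iff_continuousAt.2 fun x => ?_
  obtain ⟨L, hL⟩ := hw (closedBall x 1) (isCompact_closedBall x 1) (subset_univ _)
  exact hL.continuousOn.continuousAt (closedBall_mem_nhds x one_pos)

omit [MeasurableSpace X] in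
lemma LocLipschitzOn.lipschitz_mul [ProperSpace X] {w a : X → ℝ} {L : ℝ≥0}
    (hw : LocLipschitzOn w univ) (ha : LipschitzWith L a) (ha1 : ∀ z, |a z| ≤ 1) :
    LocLipschitzOn (fun z => a z * w z) univ := by
  intro K hK hKu
  obtain ⟨M, hM⟩ := hw K hK hKu
  obtain ⟨C, hC⟩ := hK.exists_bound_of_continuousOn hw.continuous.continuousOn
  refine ⟨M + L * Real.toNNReal C, LipschitzOnWith.of_dist_le_mul fun y hy z hz => ?_⟩
  have h1 := hM.dist_le_mul y hy z hz
  have h2 := ha.dist_le_mul y z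
  rw [Real.dist_eq] at h1 h2 ⊢
  have hz' : |w z| ≤ Real.toNNReal C := (hC z hz).trans (Real.le_coe_toNNReal C)
  calc |a y * w y - a z * w z| = |a y * (w y - w z) + (a y - a z) * w z| := by ring_nf
    _ ≤ |a y| * |w y - w z| + |a y - a z| * |w z| := by
      rw [← abs_mul, ← abs_mul]; exact abs_add_le _ _
    _ ≤ 1 * (M * dist y z) + (L * dist y z) * Real.toNNReal C := by
      gcongr
      exact ha1 y
    _ = _ := by push_cast; ring

lemma Approximates.tv_mul_cutoff_le [ProperSpace X] [BorelSpace X] {G : ℕ → X → ℝ≥0∞}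
    {c : ℝ≥0∞} (h : Approximates μ v G u c) (hc : c ≠ ⊤) {a : X → ℝ} {S : Set X} {L : ℝ≥0}
    (ha : LipschitzWith L a) (ha0 : ∀ z, 0 ≤ a z) (ha1 : ∀ z, a z ≤ 1) (hS : MeasurableSet S)
    (haS : ∀ z ∉ S, ∀ᶠ z' in 𝓝 z, a z' = a z) :
    tv μ (fun z => a z * u z) univ ≤
      liminf (fun i => ∫⁻ z, ENNReal.ofReal (a z) * G i z ∂μ +
        L * ∫⁻ z in S, ENNReal.ofReal |v i z| ∂μ) atTop := by
  have habs : ∀ z, |a z| ≤ 1 := fun z => by rw [abs_of_nonneg (ha0 z)]; exact ha1 z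
  have hvm : ∀ i, Measurable fun z => ENNReal.ofReal |v i z| := fun i =>
    ((h.locLipschitz i).continuous.measurable.norm).ennreal_ofReal
  have ham : Measurable fun z => ENNReal.ofReal (a z) := ha.continuous.measurable.ennreal_ofReal
  have key := tv_le_liminf (fun i => (h.locLipschitz i).lipschitz_mul ha habs)
    (h.tendsto.mul_cutoff habs)
    (fun i => (ham.mul (h.measurable i)).add (((hvm i).const_mul (L : ℝ≥0∞)).indicator hS))
    (fun i => (h.isUpperGradientOn i).mul_cutoff (h.measurable i)
      (ne_top_of_le_ne_top hc (h.lintegral_le i)) (h.locLipschitz i) ha ha0 haS)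
  refine key.trans_eq (congrArg (fun f => liminf f atTop) (funext fun i => ?_))
  rw [setLIntegral_univ, ← lintegral_const_mul _ (hvm i), ← lintegral_indicator hS]
  exact lintegral_add_left (ham.mul (h.measurable i)) _

/-- A cutoff at most increases the total variation by a term of order zero. -/
lemma Approximates.tv_mul_cutoff_le_add [ProperSpace X] [BorelSpace X] {G : ℕ → X → ℝ≥0∞}
    {c : ℝ≥0∞} (h : Approximates μ v G u c) (hc : c ≠ ⊤) (hu : AEMeasurable u μ)
    {a : X → ℝ} {S : Set X} {L : ℝ≥0}
    (ha : LipschitzWith L a) (ha0 : ∀ z, 0 ≤ a z) (ha1 : ∀ z, a z ≤ 1) (hS : IsCompact S)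
    (haS : ∀ z ∉ S, ∀ᶠ z' in 𝓝 z, a z' = a z) :
    tv μ (fun z => a z * u z) univ ≤ c + L * ∫⁻ z in S, ENNReal.ofReal |u z| ∂μ := by
  refine ENNReal.le_of_forall_pos_le_add fun ε hε _ => ?_
  refine (h.tv_mul_cutoff_le hc ha ha0 ha1 hS.measurableSet haS).trans ?_
  have hε' : (ε : ℝ≥0∞) / (L + 1) ≠ 0 := by simp [ENNReal.div_eq_zero_iff, hε.ne']
  refine liminf_le_of_frequently_le' (Eventually.frequently ?_)
  filter_upwards [h.tendsto.eventually_lintegral_abs_le hu hS hε'] with i hi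
  calc _ ≤ ∫⁻ z, G i z ∂μ + L * (∫⁻ z in S, ENNReal.ofReal |u z| ∂μ + ε / (L + 1)) := by
        gcongr with z
        calc ENNReal.ofReal (a z) * G i z ≤ 1 * G i z := by
              gcongr
              exact ENNReal.ofReal_le_one.2 (ha1 z)
          _ = G i z := one_mul _
    _ ≤ c + (L * ∫⁻ z in S, ENNReal.ofReal |u z| ∂μ + (L + 1) * (ε / (L + 1))) := by
        rw [mul_add]
        gcongr
        · exact h.lintegral_le i
        · exact le_self_add
    _ = _ := by
        rw [ENNReal.mul_div_cancel (by simp) (by simp), add_assoc]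

/-- If a cutoff does not decrease the total variation, then near-optimal upper gradients have
little mass where the cutoff is small. -/
lemma Approximates.eventually_lintegral_le [ProperSpace X] [BorelSpace X] {G : ℕ → X → ℝ≥0∞}
    {T ε : ℝ≥0∞} (h : Approximates μ v G u (T + ε)) (hT : T ≠ ⊤) (hε : ε ≠ 0) (hε' : ε ≠ ⊤)
    (hu : AEMeasurable u μ)
    {φ : X → ℝ} {S : Set X} {L : ℝ≥0} (hφ : LipschitzWith L φ) (hφ0 : ∀ z, 0 ≤ φ z)
    (hφ1 : ∀ z, φ z ≤ 1) (hS : IsCompact S) (hφS : ∀ z ∉ S, ∀ᶠ z' in 𝓝 z, φ z' = φ z)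
    (hmin : T ≤ tv μ (fun z => (1 - φ z) * u z) univ) :
    ∀ᶠ i in atTop, ∫⁻ z, ENNReal.ofReal (φ z) * G i z ∂μ ≤
      L * ∫⁻ z in S, ENNReal.ofReal |u z| ∂μ + (L + 2) * ε := by
  have hlip : LipschitzWith L fun z => 1 - φ z := LipschitzWith.of_dist_le_mul fun y z => by
    have := hφ.dist_le_mul z y
    rw [Real.dist_eq] at this ⊢
    rw [dist_comm y z]
    convert this using 2
    ring
  have hc : T + ε ≠ ⊤ := ENNReal.add_ne_top.2 ⟨hT, hε'⟩
  have h1 := hmin.trans (h.tv_mul_cutoff_le hc hlip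
    (fun z => sub_nonneg.2 (hφ1 z)) (fun z => by linarith [hφ0 z]) hS.measurableSet
    (fun z hz => (hφS z hz).mono fun z' hz' => by rw [hz']))
  have h2 : ∀ᶠ i in atTop, T ≤ (∫⁻ z, ENNReal.ofReal (1 - φ z) * G i z ∂μ +
      L * ∫⁻ z in S, ENNReal.ofReal |v i z| ∂μ) + ε := by
    rcases eq_or_ne T 0 with rfl | hT0
    · exact Eventually.of_forall fun _ => bot_le
    filter_upwards [eventually_lt_of_lt_liminf ((ENNReal.sub_lt_self hT hT0 hε).trans_le h1)]
      with i hi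
    exact tsub_le_iff_right.1 hi.le
  filter_upwards [h2, h.tendsto.eventually_lintegral_abs_le hu hS hε] with i hi1 hi2
  have hφm : Measurable fun z => ENNReal.ofReal (φ z) := hφ.continuous.measurable.ennreal_ofReal
  have hsplit : ∫⁻ z, ENNReal.ofReal (φ z) * G i z ∂μ + ∫⁻ z, ENNReal.ofReal (1 - φ z) * G i z ∂μ
      = ∫⁻ z, G i z ∂μ := by
    rw [← lintegral_add_left (f := fun z => ENNReal.ofReal (φ z) * G i z)
      (hφm.mul (h.measurable i))]
    refine lintegral_congr fun z => ?_
    rw [← add_mul, ← ENNReal.ofReal_add (hφ0 z) (sub_nonneg.2 (hφ1 z))]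
    simp
  have hfin : ∫⁻ z, ENNReal.ofReal (1 - φ z) * G i z ∂μ ≠ ⊤ :=
    ne_top_of_le_ne_top hc ((hsplit ▸ le_add_self).trans (h.lintegral_le i))
  refine (ENNReal.add_le_add_iff_right hfin).1 ?_
  calc _ = ∫⁻ z, G i z ∂μ := hsplit
    _ ≤ T + ε := h.lintegral_le i
    _ ≤ (∫⁻ z, ENNReal.ofReal (1 - φ z) * G i z ∂μ +
        L * (∫⁻ z in S, ENNReal.ofReal |u z| ∂μ + ε)) + ε + ε := by
        gcongr
        exact hi1.trans (by gcongr)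
    _ = _ := by ring

end TotalVariation

section Poincare

variable {μ : Measure X} {Cd CP lam : ℝ}

lemma MMS.exists_lintegral_abs_sub_le (h : MMS μ Cd CP lam) (z : X) {s : ℝ} (hs : 0 < s)
    {w : X → ℝ} (hw : LocallyIntegrable w μ) {g : X → ℝ≥0∞} (hg : Measurable g)
    (hgw : IsUpperGradientOn g w univ) :
    ∃ c, ∫⁻ y in ball z s, ENNReal.ofReal |w y - c| ∂μ ≤
      ENNReal.ofReal (CP * s) * ∫⁻ y in ball z (lam * s), g y ∂μ := by
  refine ⟨_, (h.poincare z s hs w hw g hg hgw).trans ?_⟩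
  gcongr
  calc _ ≤ ENNReal.ofReal (CP * s) * 1 := by
        gcongr
        refine ENNReal.div_le_of_le_mul ?_
        rw [one_mul]
        exact measure_mono (ball_subset_ball (le_mul_of_one_le_left hs.le h.hlam))
    _ = _ := mul_one _

omit [MetricSpace X] in
/-- A set of density at most one half is controlled by the oscillation of its characteristic
function. -/
lemma measure_inter_le_lintegral_abs_chi_sub {F B : Set X} (hF : MeasurableSet F)
    (hhalf : μ (F ∩ B) ≤ μ (B \ F)) (c : ℝ) :
    μ (F ∩ B) ≤ ∫⁻ y in B, ENNReal.ofReal |chi F y - c| ∂μ := by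
  have h1 : ∫⁻ y in B, ENNReal.ofReal |chi F y - c| ∂μ =
      ENNReal.ofReal |1 - c| * μ (F ∩ B) + ENNReal.ofReal |c| * μ (B \ F) := by
    rw [← lintegral_add_compl _ hF, Measure.restrict_restrict hF,
      Measure.restrict_restrict hF.compl]
    congr 1
    · rw [← setLIntegral_const]
      rw [← Measure.restrict_restrict hF]
      refine setLIntegral_congr_fun hF fun y hy => ?_
      simp [chi, indicator_of_mem hy]
    · rw [sdiff_eq, inter_comm B, ← setLIntegral_const]
      rw [← Measure.restrict_restrict hF.compl]
      refine setLIntegral_congr_fun hF.compl fun y hy => ?_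
      simp [chi, indicator_of_notMem hy]
  rw [h1]
  calc μ (F ∩ B) = 1 * μ (F ∩ B) := (one_mul _).symm
    _ ≤ (ENNReal.ofReal |1 - c| + ENNReal.ofReal |c|) * μ (F ∩ B) := by
      gcongr
      rw [← ENNReal.ofReal_add (abs_nonneg _) (abs_nonneg _), ← ENNReal.ofReal_one]
      apply ENNReal.ofReal_le_ofReal
      calc (1 : ℝ) = |1 - c + c| := by simp
        _ ≤ _ := abs_add_le _ _
    _ = ENNReal.ofReal |1 - c| * μ (F ∩ B) + ENNReal.ofReal |c| * μ (F ∩ B) := add_mul _ _ _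
    _ ≤ _ := by gcongr

omit [MetricSpace X] in
/-- A function vanishing on `Z ⊆ B` is controlled by its oscillation on `B`. -/
lemma lintegral_abs_le_of_eq_zero {w : X → ℝ} {B Z : Set X} {M : ℝ≥0∞}
    (hZB : Z ⊆ B) (hZ : μ B ≤ M * μ Z) (hZm : MeasurableSet Z)
    (hw : ∀ᵐ y ∂μ, y ∈ Z → w y = 0) (c : ℝ) :
    ∫⁻ y in B, ENNReal.ofReal |w y| ∂μ ≤
      (1 + M) * ∫⁻ y in B, ENNReal.ofReal |w y - c| ∂μ := by
  have hc : ENNReal.ofReal |c| * μ Z ≤ ∫⁻ y in B, ENNReal.ofReal |w y - c| ∂μ := by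
    calc ENNReal.ofReal |c| * μ Z = ∫⁻ y in Z, ENNReal.ofReal |c| ∂μ := by
          rw [setLIntegral_const]
      _ = ∫⁻ y in Z, ENNReal.ofReal |w y - c| ∂μ := by
          refine setLIntegral_congr_fun_ae hZm ?_
          filter_upwards [hw] with y hy hyZ
          rw [hy hyZ, zero_sub, abs_neg]
      _ ≤ _ := lintegral_mono_set hZB
  calc ∫⁻ y in B, ENNReal.ofReal |w y| ∂μ
      ≤ ∫⁻ y in B, (ENNReal.ofReal |w y - c| + ENNReal.ofReal |c|) ∂μ := by
        refine lintegral_mono fun y => ?_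
        rw [← ENNReal.ofReal_add (abs_nonneg _) (abs_nonneg _)]
        apply ENNReal.ofReal_le_ofReal
        calc |w y| = |w y - c + c| := by ring_nf
          _ ≤ _ := abs_add_le _ _
    _ = ∫⁻ y in B, ENNReal.ofReal |w y - c| ∂μ + ENNReal.ofReal |c| * μ B := by
        rw [lintegral_add_right _ measurable_const, setLIntegral_const]
    _ ≤ ∫⁻ y in B, ENNReal.ofReal |w y - c| ∂μ + ENNReal.ofReal |c| * (M * μ Z) := by gcongr
    _ = ∫⁻ y in B, ENNReal.ofReal |w y - c| ∂μ + M * (ENNReal.ofReal |c| * μ Z) := by ring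
    _ ≤ ∫⁻ y in B, ENNReal.ofReal |w y - c| ∂μ +
        M * ∫⁻ y in B, ENNReal.ofReal |w y - c| ∂μ := by gcongr
    _ = _ := by ring

end Poincare

section Sobolev

variable {μ : Measure X} {Cd CP lam : ℝ}

omit [MeasurableSpace X] in
lemma exists_lt_dist {x : X} {r : ℝ}
    (h : ENNReal.ofReal (2 * r) < ediam (univ : Set X)) :
    ∃ p, r < dist x p := by
  by_contra! hcon
  refine h.not_ge (ediam_le_of_forall_dist_le fun p _ q _ => ?_)
  have := dist_triangle_left p q x
  linarith [hcon p, hcon q]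

/-- Annuli inside the space are nonempty. -/
lemma MMS.exists_dist_mem_Ico [BorelSpace X] (h : MMS μ Cd CP lam) {x p : X} {a b : ℝ}
    (ha : 0 < a) (hab : a < b) (hp : a < dist x p) : ∃ z, a ≤ dist x z ∧ dist x z < b := by
  by_contra! hcon
  have := h.isLocallyFiniteMeasure
  have hug : IsUpperGradientOn (fun _ => 0) (chi (ball x a)) univ := by
    intro γ _
    have hc : ContinuousOn (fun t => dist x (γ.toFun t)) (Icc 0 1) := by
      obtain ⟨K, hK⟩ := γ.lipschitz
      exact (continuous_const.dist continuous_id).comp_continuousOn hK.continuousOn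
    have key : ∀ s ∈ Icc (0 : ℝ) 1, ∀ t ∈ Icc (0 : ℝ) 1, dist x (γ.toFun s) < a →
        dist x (γ.toFun t) < a := by
      intro s hs t ht hsa
      by_contra! hta
      obtain ⟨τ, _, hτ'⟩ := isPreconnected_Icc.intermediate_value hs ht hc ⟨hsa.le, hta⟩
      exact absurd (hcon _ hτ'.ge) (by rw [show dist x (γ.toFun τ) = a from hτ']; exact hab.not_ge)
    have : chi (ball x a) (γ.toFun 1) = chi (ball x a) (γ.toFun 0) := by
      unfold chi
      have hiff : γ.toFun 1 ∈ ball x a ↔ γ.toFun 0 ∈ ball x a := by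
        rw [mem_ball', mem_ball']
        exact ⟨key 1 (by simp) 0 (by simp), key 0 (by simp) 1 (by simp)⟩
      by_cases h0 : γ.toFun 0 ∈ ball x a
      · rw [indicator_of_mem h0, indicator_of_mem (hiff.2 h0)]
      · rw [indicator_of_notMem h0, indicator_of_notMem (mt hiff.1 h0)]
    simp [this]
  set r := 2 * dist x p + a with hr
  have hloc : LocallyIntegrable (chi (ball x a)) μ :=
    (locallyIntegrable_const (1 : ℝ)).indicator measurableSet_ball
  obtain ⟨c, hc⟩ := h.exists_lintegral_abs_sub_le x (s := r) (by positivity) hloc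
    measurable_const hug
  have hcz : ∫⁻ y in ball x r, ENNReal.ofReal |chi (ball x a) y - c| ∂μ = 0 := by simpa using hc
  set Z := ball p (dist x p - a)
  have hZpos : 0 < μ Z := h.ball_pos p (by linarith)
  have hZtop : μ Z < ⊤ := h.ball_lt_top p _
  have hlow := lintegral_abs_le_of_eq_zero (μ := μ) (w := chi (ball x a)) (B := ball x r) (Z := Z)
    (M := μ (ball x r) / μ Z) (ball_subset_ball' (by rw [dist_comm p x]; linarith))
    (by rw [ENNReal.div_mul_cancel hZpos.ne' hZtop.ne]) measurableSet_ball
    (Eventually.of_forall fun y hy => by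
      refine indicator_of_notMem (fun hy' => ?_) _
      rw [mem_ball] at hy
      rw [mem_ball'] at hy'
      have := dist_triangle x y p
      linarith) c
  rw [hcz, mul_zero] at hlow
  have : μ (ball x a) ≤ 0 := by
    refine le_trans ?_ hlow
    calc μ (ball x a) = ∫⁻ y in ball x a, 1 ∂μ := by simp
      _ ≤ ∫⁻ y in ball x a, ENNReal.ofReal |chi (ball x a) y| ∂μ := by
        refine setLIntegral_mono' measurableSet_ball fun y hy => ?_
        simp [chi, indicator_of_mem hy]
      _ ≤ _ := lintegral_mono_set (ball_subset_ball (by linarith [dist_nonneg (x := x) (y := p)]))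
  exact (h.ball_pos x ha).not_ge this

/-- The oscillation of `u` is controlled by near-optimal upper gradients. -/
lemma Approximates.exists_lintegral_abs_sub_le [BorelSpace X] (h : MMS μ Cd CP lam) {u : X → ℝ}
    {v : ℕ → X → ℝ} {G : ℕ → X → ℝ≥0∞} {c : ℝ≥0∞} (hv : Approximates μ v G u c)
    (z : X) {s : ℝ} (hs : 0 < s) (i : ℕ) :
    ∃ c, ∫⁻ y in ball z s, ENNReal.ofReal |u y - c| ∂μ ≤
      ∫⁻ y in ball z s, ENNReal.ofReal |v i y - u y| ∂μ +
        ENNReal.ofReal (CP * s) * ∫⁻ y in ball z (lam * s), G i y ∂μ := by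
  have := h.properSpace
  have := h.isLocallyFiniteMeasure
  have hcont := (hv.locLipschitz i).continuous
  obtain ⟨c, hc⟩ := h.exists_lintegral_abs_sub_le z hs hcont.locallyIntegrable (hv.measurable i)
    (hv.isUpperGradientOn i)
  refine ⟨c, ?_⟩
  calc _ ≤ ∫⁻ y in ball z s, (ENNReal.ofReal |v i y - u y| + ENNReal.ofReal |v i y - c|) ∂μ := by
        refine lintegral_mono fun y => ?_
        rw [← ENNReal.ofReal_add (abs_nonneg _) (abs_nonneg _)]
        apply ENNReal.ofReal_le_ofReal
        rw [abs_sub_comm (v i y) (u y)]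
        exact abs_sub_le _ _ _
    _ = ∫⁻ y in ball z s, ENNReal.ofReal |v i y - u y| ∂μ +
        ∫⁻ y in ball z s, ENNReal.ofReal |v i y - c| ∂μ :=
        lintegral_add_right _ (hcont.measurable.sub_const c).norm.ennreal_ofReal
    _ ≤ _ := by gcongr

/-- A Sobolev inequality for functions vanishing outside a ball. -/
lemma Approximates.lintegral_abs_le [BorelSpace X] (h : MMS μ Cd CP lam) {u : X → ℝ}
    {v : ℕ → X → ℝ} {G : ℕ → X → ℝ≥0∞} {c : ℝ≥0∞} (hv : Approximates μ v G u c)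
    {x : X} {R : ℝ} (hR : 0 < R) (hdiam : ENNReal.ofReal (6 * R) < ediam (univ : Set X))
    (hu : ∀ᵐ y ∂μ, y ∉ ball x (2 * R) → u y = 0) :
    ∫⁻ y, ENNReal.ofReal |u y| ∂μ ≤
      (1 + ENNReal.ofReal Cd ^ 4) * (ENNReal.ofReal (CP * (5 * R)) * c) := by
  have := h.properSpace
  obtain ⟨p, hp⟩ := exists_lt_dist (x := x) (r := 3 * R)
    (by rwa [show 2 * (3 * R) = 6 * R by ring])
  obtain ⟨z, hz1, hz2⟩ := h.exists_dist_mem_Ico (by positivity) (by linarith) hp (b := 4 * R)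
  have hball : ∫⁻ y, ENNReal.ofReal |u y| ∂μ = ∫⁻ y in ball x (5 * R), ENNReal.ofReal |u y| ∂μ := by
    rw [← lintegral_indicator measurableSet_ball]
    refine lintegral_congr_ae ?_
    filter_upwards [hu] with y hy
    by_cases hy5 : y ∈ ball x (5 * R)
    · rw [indicator_of_mem hy5]
    · rw [indicator_of_notMem hy5, hy fun hy2 => hy5 (ball_subset_ball (by linarith) hy2)]
      simp
  rw [hball]
  refine ENNReal.le_of_forall_pos_le_add fun ε hε _ => ?_
  set M : ℝ≥0∞ := 1 + ENNReal.ofReal Cd ^ 4 with hM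
  have hMtop : M ≠ ⊤ := ENNReal.add_ne_top.2
    ⟨ENNReal.one_ne_top, ENNReal.pow_ne_top ENNReal.ofReal_ne_top⟩
  have hM0 : M ≠ 0 := by simp [hM]
  have hδ : (ε : ℝ≥0∞) / M ≠ 0 := by simp [ENNReal.div_eq_zero_iff, hε.ne', hMtop]
  obtain ⟨i, hi⟩ := ((hv.tendsto (closedBall x (5 * R)) (isCompact_closedBall _ _)
    (subset_univ _)).eventually_lt_const (pos_iff_ne_zero.2 hδ)).exists
  obtain ⟨d, hd⟩ := hv.exists_lintegral_abs_sub_le h x (s := 5 * R) (by positivity) i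
  have key := lintegral_abs_le_of_eq_zero (μ := μ) (w := u) (B := ball x (5 * R)) (Z := ball z R)
    (M := ENNReal.ofReal Cd ^ 4) (ball_subset_ball' (by rw [dist_comm z x]; linarith))
    (h.ball_le_ball hR 4 (by linarith)) measurableSet_ball (by
      filter_upwards [hu] with y hy hyz
      refine hy fun hyx => ?_
      rw [mem_ball] at hyz
      rw [mem_ball'] at hyx
      have := dist_triangle x y z
      linarith) d
  calc _ ≤ M * ∫⁻ y in ball x (5 * R), ENNReal.ofReal |u y - d| ∂μ := key
    _ ≤ M * (∫⁻ y in ball x (5 * R), ENNReal.ofReal |v i y - u y| ∂μ +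
        ENNReal.ofReal (CP * (5 * R)) * ∫⁻ y in ball x (lam * (5 * R)), G i y ∂μ) := by gcongr
    _ ≤ M * (ε / M + ENNReal.ofReal (CP * (5 * R)) * c) := by
        gcongr
        · exact (lintegral_mono_set ball_subset_closedBall).trans hi.le
        · exact (setLIntegral_le_lintegral _ _).trans (hv.lintegral_le i)
    _ = _ := by
        rw [mul_add, ENNReal.mul_div_cancel hM0 hMtop, add_comm]

end Sobolev

section Smoothing

/-- The tent kernel at scale `ε`. -/
def tent (ε : ℝ) (x y : X) : ℝ := max 0 (1 - dist x y / ε)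

/-- The convolution of `u` with the normalized tent kernel at scale `ε`. -/
def smoothing (μ : Measure X) (ε : ℝ) (u : X → ℝ) (x : X) : ℝ :=
  (∫ y, tent ε x y * u y ∂μ) / ∫ y, tent ε x y ∂μ

section Tent

variable {ε : ℝ} {x x' y : X}

omit [MeasurableSpace X]

lemma tent_nonneg : 0 ≤ tent ε x y := le_max_left _ _

lemma tent_le_one (hε : 0 < ε) : tent ε x y ≤ 1 :=
  max_le zero_le_one (by linarith [div_nonneg (dist_nonneg (x := x) (y := y)) hε.le])

lemma abs_tent_le_one (hε : 0 < ε) : |tent ε x y| ≤ 1 := by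
  rw [abs_of_nonneg tent_nonneg]; exact tent_le_one hε

lemma tent_eq_zero (hε : 0 < ε) (h : ε ≤ dist x y) : tent ε x y = 0 := by
  have := (one_le_div hε).2 h
  exact max_eq_left (by linarith)

lemma half_le_tent (hε : 0 < ε) (h : dist x y ≤ ε / 2) : 1 / 2 ≤ tent ε x y := by
  have : dist x y / ε ≤ 1 / 2 := by rw [div_le_iff₀ hε]; linarith
  exact le_max_of_le_right (by linarith)

lemma abs_tent_sub_le (hε : 0 < ε) : |tent ε x y - tent ε x' y| ≤ dist x x' / ε := by
  refine (abs_max_sub_max_le_max _ _ _ _).trans ?_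
  rw [sub_self, abs_zero, show 1 - dist x y / ε - (1 - dist x' y / ε) =
    (dist x' y - dist x y) / ε by ring, abs_div, abs_of_pos hε]
  refine max_le (by positivity) ?_
  gcongr
  rw [abs_sub_comm]
  exact abs_dist_sub_le _ _ _

lemma continuous_tent : Continuous (tent ε x) := by
  unfold tent
  fun_prop

end Tent

variable {μ : Measure X} {Cd CP lam ε : ℝ} {u w : X → ℝ}

lemma integrable_mul_of_eq_zero [ProperSpace X] [BorelSpace X] {f : X → ℝ} {x : X} {r c : ℝ}
    (hf : Continuous f) (hfc : ∀ y, |f y| ≤ c) (hf0 : ∀ y ∉ ball x r, f y = 0)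
    (hw : LocallyIntegrable w μ) : Integrable (fun y => f y * w y) μ := by
  have h1 : Integrable ((closedBall x r).indicator w) μ :=
    (integrable_indicator_iff measurableSet_closedBall).2
      (hw.integrableOn_isCompact (isCompact_closedBall x r))
  refine (h1.bdd_mul hf.aestronglyMeasurable (Eventually.of_forall hfc)).congr
    (Eventually.of_forall fun y => ?_)
  by_cases hy : y ∈ closedBall x r
  · simp [indicator_of_mem hy]
  · simp [hf0 y fun hy' => hy (ball_subset_closedBall hy')]

lemma abs_integral_mul_le [ProperSpace X] [BorelSpace X] {f : X → ℝ} {x : X} {r c : ℝ}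
    (hfc : ∀ y, |f y| ≤ c) (hf0 : ∀ y ∉ ball x r, f y = 0)
    (hw : LocallyIntegrable w μ) : |∫ y, f y * w y ∂μ| ≤ c * ∫ y in ball x r, |w y| ∂μ := by
  have h1 : IntegrableOn w (ball x r) μ :=
    (hw.integrableOn_isCompact (isCompact_closedBall x r)).mono_set ball_subset_closedBall
  rw [← integral_const_mul, ← Real.norm_eq_abs]
  rw [← setIntegral_eq_integral_of_forall_compl_eq_zero (s := ball x r)
    (fun y hy => by rw [hf0 y hy, zero_mul])]
  refine norm_integral_le_of_norm_le (h1.abs.const_mul c) (Eventually.of_forall fun y => ?_)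
  rw [Real.norm_eq_abs, abs_mul]
  exact mul_le_mul_of_nonneg_right (hfc y) (abs_nonneg _)

lemma abs_div_sub_div_le {b b' a a' δ I m D : ℝ} (hm : 0 < m) (hD : 0 < D) (hδ : 0 ≤ δ)
    (hI : 0 ≤ I) (ha : m ≤ D * a) (ha' : m ≤ D * a') (hb : |b| ≤ I) (hbb : |b' - b| ≤ δ * I)
    (haa : |a' - a| ≤ δ * m) : |b' / a' - b / a| ≤ (D + D ^ 2) * δ * (I / m) := by
  have ha0 : 0 < a := by nlinarith
  have ha0' : 0 < a' := by nlinarith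
  have hinv : 1 / a ≤ D / m := by rw [div_le_div_iff₀ ha0 hm]; linarith
  have hinv' : 1 / a' ≤ D / m := by rw [div_le_div_iff₀ ha0' hm]; linarith
  have h1 : b' / a' - b / a = (b' - b) * (1 / a') - b * (a' - a) * (1 / a * (1 / a')) := by
    field_simp
    ring
  calc |b' / a' - b / a| ≤ |(b' - b) * (1 / a')| + |b * (a' - a) * (1 / a * (1 / a'))| := by
        rw [h1]; exact abs_sub _ _
    _ = |b' - b| * (1 / a') + |b| * |a' - a| * (1 / a * (1 / a')) := by
        rw [abs_mul, abs_mul, abs_mul, abs_of_pos (one_div_pos.2 ha0'),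
          abs_of_pos (mul_pos (one_div_pos.2 ha0) (one_div_pos.2 ha0'))]
    _ ≤ δ * I * (D / m) + I * (δ * m) * (D / m * (D / m)) := by gcongr
    _ = _ := by field_simp

lemma MMS.measureReal_ball_le [BorelSpace X] (h : MMS μ Cd CP lam) {x y : X} {r s : ℝ}
    (hs : 0 < s) (k : ℕ) (hk : r + dist x y ≤ 2 ^ k * s) :
    μ.real (ball x r) ≤ Cd ^ k * μ.real (ball y s) := by
  have h1 := h.ball_le_ball hs k hk
  have h2 := ENNReal.toReal_mono (ENNReal.mul_ne_top (ENNReal.pow_ne_top ENNReal.ofReal_ne_top)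
    (h.ball_lt_top y s).ne) h1
  rwa [ENNReal.toReal_mul, ENNReal.toReal_pow, ENNReal.toReal_ofReal (by linarith [h.hCd])] at h2

lemma MMS.measureReal_ball_pos (h : MMS μ Cd CP lam) (x : X) {r : ℝ} (hr : 0 < r) :
    0 < μ.real (ball x r) :=
  ENNReal.toReal_pos (h.ball_pos x hr).ne' (h.ball_lt_top x r).ne

variable [BorelSpace X]

lemma MMS.integrable_tent_mul (h : MMS μ Cd CP lam) (hε : 0 < ε) (x : X)
    (hw : LocallyIntegrable w μ) : Integrable (fun y => tent ε x y * w y) μ := by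
  have := h.properSpace
  exact integrable_mul_of_eq_zero (x := x) (r := ε) continuous_tent
    (fun y => abs_tent_le_one hε) (fun y hy => tent_eq_zero hε (by simpa [dist_comm] using hy)) hw

lemma MMS.integrable_tent (h : MMS μ Cd CP lam) (hε : 0 < ε) (x : X) :
    Integrable (tent ε x) μ := by
  have := h.isLocallyFiniteMeasure
  simpa using h.integrable_tent_mul hε x (locallyIntegrable_const (1 : ℝ))

lemma MMS.measureReal_ball_le_integral_tent (h : MMS μ Cd CP lam) (hε : 0 < ε) (x : X) :
    μ.real (ball x (ε / 2)) ≤ 2 * ∫ y, tent ε x y ∂μ := by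
  have h1 : ∫ y in ball x (ε / 2), (1 / 2 : ℝ) ∂μ ≤ ∫ y in ball x (ε / 2), tent ε x y ∂μ := by
    refine setIntegral_mono_on ?_ (h.integrable_tent hε x).integrableOn measurableSet_ball
      fun y hy => half_le_tent hε (mem_ball'.1 hy).le
    exact integrableOn_const (h.ball_lt_top x _).ne
  have h2 : ∫ y in ball x (ε / 2), tent ε x y ∂μ ≤ ∫ y, tent ε x y ∂μ :=
    setIntegral_le_integral (h.integrable_tent hε x) (Eventually.of_forall fun y => tent_nonneg)
  rw [setIntegral_const, smul_eq_mul] at h1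
  linarith

lemma MMS.integral_tent_pos (h : MMS μ Cd CP lam) (hε : 0 < ε) (x : X) :
    0 < ∫ y, tent ε x y ∂μ := by
  have h1 := h.measureReal_ball_le_integral_tent hε x
  have h2 := h.measureReal_ball_pos x (half_pos hε)
  linarith

lemma MMS.integral_tent_mul_sub (h : MMS μ Cd CP lam) (hε : 0 < ε) (x : X)
    (hu : LocallyIntegrable u μ) (c : ℝ) :
    ∫ y, tent ε x y * (u y - c) ∂μ = ∫ y, tent ε x y * u y ∂μ - c * ∫ y, tent ε x y ∂μ := by
  simp only [mul_sub]
  rw [integral_sub (h.integrable_tent_mul hε x hu) ((h.integrable_tent hε x).mul_const c),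
    integral_mul_const, mul_comm c]

lemma MMS.smoothing_sub (h : MMS μ Cd CP lam) (hε : 0 < ε) (x : X)
    (hu : LocallyIntegrable u μ) (c : ℝ) :
    smoothing μ ε u x - c = (∫ y, tent ε x y * (u y - c) ∂μ) / ∫ y, tent ε x y ∂μ := by
  rw [h.integral_tent_mul_sub hε x hu, sub_div, smoothing,
    mul_div_cancel_right₀ _ (h.integral_tent_pos hε x).ne']

lemma MMS.abs_smoothing_sub_le (h : MMS μ Cd CP lam) (hε : 0 < ε) {x x' : X}
    (hx : dist x' x < ε) (hu : LocallyIntegrable u μ) (c : ℝ) :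
    |smoothing μ ε u x' - smoothing μ ε u x| ≤
      (2 * Cd ^ 3 + (2 * Cd ^ 3) ^ 2) * (dist x' x / ε) *
        ((∫ y in ball x (2 * ε), |u y - c| ∂μ) / μ.real (ball x (2 * ε))) := by
  have := h.properSpace
  have := h.isLocallyFiniteMeasure
  have hw : LocallyIntegrable (fun y => u y - c) μ := hu.sub (locallyIntegrable_const c)
  have hCd := h.hCd
  have hCd3 : 0 < Cd ^ 3 := by positivity
  have hsupp : ∀ {z y : X}, dist z x < ε → y ∉ ball x (2 * ε) → tent ε z y = 0 := by
    intro z y hz hy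
    rw [mem_ball', not_lt] at hy
    have := dist_triangle_left x y z
    exact tent_eq_zero hε (by linarith)
  have hxx : dist x x < ε := by rwa [dist_self]
  have hlow : ∀ z, dist z x < ε →
      μ.real (ball x (2 * ε)) ≤ 2 * Cd ^ 3 * ∫ y, tent ε z y ∂μ := by
    intro z hz
    have h1 := h.measureReal_ball_le (x := x) (y := z) (r := 2 * ε) (half_pos hε) 3
      (by rw [dist_comm] at hz; linarith)
    have h2 := h.measureReal_ball_le_integral_tent hε z
    nlinarith
  have hdiff : ∀ {f : X → ℝ}, LocallyIntegrable f μ →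
      |∫ y, tent ε x' y * f y ∂μ - ∫ y, tent ε x y * f y ∂μ| ≤
        dist x' x / ε * ∫ y in ball x (2 * ε), |f y| ∂μ := by
    intro f hf
    rw [← integral_sub (h.integrable_tent_mul hε x' hf) (h.integrable_tent_mul hε x hf)]
    simp only [← sub_mul]
    exact abs_integral_mul_le (fun y => abs_tent_sub_le hε)
      (fun y hy => by rw [hsupp hx hy, hsupp hxx hy, sub_zero]) hf
  rw [← sub_sub_sub_cancel_right _ _ c, h.smoothing_sub hε x hu, h.smoothing_sub hε x' hu]
  refine abs_div_sub_div_le (h.measureReal_ball_pos x (by positivity)) (by positivity)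
    (by positivity) (integral_nonneg fun y => abs_nonneg _) (hlow x hxx) (hlow x' hx) ?_ (hdiff hw) ?_
  · simpa using abs_integral_mul_le (fun y => abs_tent_le_one hε) (fun y hy => hsupp hxx hy) hw
  · simpa using hdiff (locallyIntegrable_const (1 : ℝ))

lemma MMS.smoothing_mem_Icc (h : MMS μ Cd CP lam) (hε : 0 < ε) (hu : LocallyIntegrable u μ)
    (hu0 : ∀ y, 0 ≤ u y) (hu1 : ∀ y, u y ≤ 1) (x : X) : smoothing μ ε u x ∈ Icc (0 : ℝ) 1 := by
  refine ⟨div_nonneg (integral_nonneg fun y => mul_nonneg tent_nonneg (hu0 y))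
    (h.integral_tent_pos hε x).le, (div_le_one (h.integral_tent_pos hε x)).2 ?_⟩
  exact integral_mono (h.integrable_tent_mul hε x hu) (h.integrable_tent hε x)
    fun y => mul_le_of_le_one_right tent_nonneg (hu1 y)

lemma MMS.locLipschitzOn_smoothing (h : MMS μ Cd CP lam) (hε : 0 < ε)
    (hu : LocallyIntegrable u μ) (hu0 : ∀ y, 0 ≤ u y) (hu1 : ∀ y, u y ≤ 1) :
    LocLipschitzOn (smoothing μ ε u) univ := by
  have := h.properSpace
  have hCd := h.hCd
  set D := 2 * Cd ^ 3 + (2 * Cd ^ 3) ^ 2 with hD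
  have hD1 : 1 ≤ D := by
    have : 1 ≤ Cd ^ 3 := one_le_pow₀ hCd
    nlinarith
  intro K _ _
  refine ⟨Real.toNNReal (D / ε), LipschitzOnWith.of_dist_le_mul fun x' _ x _ => ?_⟩
  rw [Real.dist_eq, Real.coe_toNNReal _ (by positivity)]
  rcases lt_or_ge (dist x' x) ε with hx | hx
  · refine (h.abs_smoothing_sub_le hε hx hu 0).trans ?_
    have h1 : (∫ y in ball x (2 * ε), |u y - 0| ∂μ) / μ.real (ball x (2 * ε)) ≤ 1 := by
      refine (div_le_one (h.measureReal_ball_pos x (by positivity))).2 ?_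
      have hI : IntegrableOn u (ball x (2 * ε)) μ :=
        (hu.integrableOn_isCompact (isCompact_closedBall x _)).mono_set ball_subset_closedBall
      calc ∫ y in ball x (2 * ε), |u y - 0| ∂μ ≤ ∫ y in ball x (2 * ε), (1 : ℝ) ∂μ := by
            simp only [sub_zero]
            refine setIntegral_mono_on hI.abs (integrableOn_const (h.ball_lt_top x _).ne)
              measurableSet_ball fun y _ => ?_
            rw [abs_of_nonneg (hu0 y)]
            exact hu1 y
        _ = _ := by simp
    calc _ ≤ D * (dist x' x / ε) * 1 := by gcongr
      _ = _ := by ring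
  · have h0 := h.smoothing_mem_Icc hε hu hu0 hu1 x
    have h1 := h.smoothing_mem_Icc hε hu hu0 hu1 x'
    calc |smoothing μ ε u x' - smoothing μ ε u x| ≤ 1 :=
          abs_sub_le_iff.2 ⟨by linarith [h1.2, h0.1], by linarith [h0.2, h1.1]⟩
      _ ≤ D * (dist x' x / ε) := one_le_mul_of_one_le_of_one_le hD1 ((one_le_div hε).2 hx)
      _ = _ := by ring

/-- Smoothing increases upper gradients by at most a bounded factor. -/
lemma MMS.exists_isUpperGradientOn_smoothing (h : MMS μ Cd CP lam) (hε : 0 < ε)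
    (hu : LocallyIntegrable u μ) (hu0 : ∀ y, 0 ≤ u y) (hu1 : ∀ y, u y ≤ 1)
    {g : X → ℝ≥0∞} (hg : Measurable g) (hgu : IsUpperGradientOn g u univ)
    (hfin : ∫⁻ y, g y ∂μ ≠ ⊤) {k : ℕ} (hk : 2 * lam ≤ 2 ^ k) :
    ∃ G : X → ℝ≥0∞, Measurable G ∧ IsUpperGradientOn G (smoothing μ ε u) univ ∧
      ∫⁻ y, G y ∂μ ≤ ENNReal.ofReal ((2 * Cd ^ 3 + (2 * Cd ^ 3) ^ 2) * (2 * CP)) *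
        (ENNReal.ofReal Cd ^ k * ∫⁻ y, g y ∂μ) := by
  have := h.properSpace
  have := h.isLocallyFiniteMeasure
  have := secondCountable_of_proper (α := X)
  have hCd := h.hCd
  have hCP := h.hCP
  set D := 2 * Cd ^ 3 + (2 * Cd ^ 3) ^ 2 with hD
  have hD0 : 0 < D := by positivity
  set H : X → ℝ≥0∞ := fun x => (∫⁻ y in ball x (lam * (2 * ε)), g y ∂μ) / μ (ball x (2 * ε))
  have hH : Measurable H := (measurable_lintegral_ball hg _).div (measurable_measure_ball _)
  have hHfin : ∀ x, H x ≠ ⊤ := fun x => ENNReal.div_ne_top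
    (ne_top_of_le_ne_top hfin (setLIntegral_le_lintegral _ _)) (h.ball_pos x (by positivity)).ne'
  have hfinG : ∀ x, ENNReal.ofReal (D * (2 * CP)) * H x ≠ ⊤ := fun x =>
    ENNReal.mul_ne_top ENNReal.ofReal_ne_top (hHfin x)
  refine ⟨fun x => ENNReal.ofReal (D * (2 * CP)) * H x, hH.const_mul _, ?_, ?_⟩
  · have key := (h.locLipschitzOn_smoothing hε hu hu0 hu1).isUpperGradientOn
      (L := fun x => (ENNReal.ofReal (D * (2 * CP)) * H x).toNNReal) (fun x => ?_)
    · simpa only [ENNReal.coe_toNNReal (hfinG _)] using key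
    obtain ⟨c, hc⟩ := h.exists_lintegral_abs_sub_le x (s := 2 * ε) (by positivity) hu hg hgu
    have hw : LocallyIntegrable (fun y => u y - c) μ := hu.sub (locallyIntegrable_const c)
    have hI : IntegrableOn (fun y => u y - c) (ball x (2 * ε)) μ :=
      (hw.integrableOn_isCompact (isCompact_closedBall x _)).mono_set ball_subset_closedBall
    have hosc : (∫ y in ball x (2 * ε), |u y - c| ∂μ) / μ.real (ball x (2 * ε)) ≤
        CP * (2 * ε) * (H x).toReal := by
      have h1 : ENNReal.ofReal (∫ y in ball x (2 * ε), |u y - c| ∂μ) ≤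
          ENNReal.ofReal (CP * (2 * ε)) * ∫⁻ y in ball x (lam * (2 * ε)), g y ∂μ := by
        rw [ofReal_integral_eq_lintegral_ofReal hI.abs (Eventually.of_forall fun y => abs_nonneg _)]
        exact hc
      have h2 := ENNReal.toReal_mono (ENNReal.mul_ne_top ENNReal.ofReal_ne_top
        (ne_top_of_le_ne_top hfin (setLIntegral_le_lintegral _ _))) h1
      rw [ENNReal.toReal_ofReal (integral_nonneg fun y => abs_nonneg _), ENNReal.toReal_mul,
        ENNReal.toReal_ofReal (by positivity)] at h2
      rw [ENNReal.toReal_div, ← mul_div_assoc]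
      exact div_le_div_of_nonneg_right h2 measureReal_nonneg
    filter_upwards [ball_mem_nhds x hε] with x' hx'
    refine (h.abs_smoothing_sub_le hε hx' hu c).trans ?_
    calc _ ≤ D * (dist x' x / ε) * (CP * (2 * ε) * (H x).toReal) := by gcongr
      _ = D * (2 * CP) * (H x).toReal * dist x' x := by field_simp
      _ = _ := by
        rw [ENNReal.coe_toNNReal_eq_toReal, ENNReal.toReal_mul, ENNReal.toReal_ofReal (by positivity)]
  · rw [lintegral_const_mul _ hH]
    gcongr
    exact h.lintegral_ball_div_le hg (by positivity) (by nlinarith)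

end Smoothing

section SmoothingLimit

variable {μ : Measure X} {Cd CP lam ε : ℝ} {u : X → ℝ} [BorelSpace X]

lemma MMS.abs_smoothing_sub_self_le (h : MMS μ Cd CP lam) (hε : 0 < ε)
    (hu : LocallyIntegrable u μ) (x : X) :
    |smoothing μ ε u x - u x| ≤ 2 * Cd ^ 2 * ⨍ y in closedBall x ε, ‖u y - u x‖ ∂μ := by
  have := h.properSpace
  have := h.isLocallyFiniteMeasure
  have hw : LocallyIntegrable (fun y => u y - u x) μ := hu.sub (locallyIntegrable_const _)
  have hcb : 0 < μ.real (closedBall x ε) :=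
    (h.measureReal_ball_pos x hε).trans_le (measureReal_mono ball_subset_closedBall
      (isCompact_closedBall x ε).measure_lt_top.ne)
  have hlow : μ.real (closedBall x ε) ≤ 2 * Cd ^ 2 * ∫ y, tent ε x y ∂μ := by
    have h1 : μ.real (closedBall x ε) ≤ μ.real (ball x (2 * ε)) :=
      measureReal_mono (closedBall_subset_ball (by linarith)) (h.ball_lt_top x _).ne
    have h2 := h.measureReal_ball_le (x := x) (y := x) (r := 2 * ε) (half_pos hε) 2
      (by rw [dist_self]; linarith)
    have h3 := h.measureReal_ball_le_integral_tent hε x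
    have h4 : 0 < Cd ^ 2 := by have := h.hCd; positivity
    nlinarith
  have ha := h.integral_tent_pos hε x
  have hI : IntegrableOn (fun y => u y - u x) (closedBall x ε) μ :=
    hw.integrableOn_isCompact (isCompact_closedBall x ε)
  have hnum : |∫ y, tent ε x y * (u y - u x) ∂μ| ≤ ∫ y in closedBall x ε, |u y - u x| ∂μ := by
    refine (abs_integral_mul_le (x := x) (r := ε) (c := 1) (fun y => abs_tent_le_one hε)
      (fun y hy => tent_eq_zero hε (by rwa [mem_ball', not_lt] at hy)) hw).trans ?_
    rw [one_mul]
    exact setIntegral_mono_set hI.abs (Eventually.of_forall fun y => abs_nonneg _)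
      (LE.le.eventuallyLE ball_subset_closedBall)
  rw [h.smoothing_sub hε x hu, abs_div, abs_of_pos ha, setAverage_eq, smul_eq_mul]
  simp only [Real.norm_eq_abs]
  have hJ : 0 ≤ ∫ y in closedBall x ε, |u y - u x| ∂μ := integral_nonneg fun y => abs_nonneg _
  calc _ ≤ (∫ y in closedBall x ε, |u y - u x| ∂μ) / ∫ y, tent ε x y ∂μ := by gcongr
    _ ≤ _ := by
      rw [div_le_iff₀ ha]
      calc ∫ y in closedBall x ε, |u y - u x| ∂μ
          = μ.real (closedBall x ε) * ((μ.real (closedBall x ε))⁻¹ *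
            ∫ y in closedBall x ε, |u y - u x| ∂μ) := by field_simp
        _ ≤ (2 * Cd ^ 2 * ∫ y, tent ε x y ∂μ) * ((μ.real (closedBall x ε))⁻¹ *
            ∫ y in closedBall x ε, |u y - u x| ∂μ) := by gcongr
        _ = _ := by ring

lemma MMS.ae_tendsto_smoothing (h : MMS μ Cd CP lam) (hu : LocallyIntegrable u μ) :
    ∀ᵐ x ∂μ, Tendsto (fun n : ℕ => smoothing μ (1 / ((n : ℝ) + 1)) u x) atTop (𝓝 (u x)) := by
  have := h.properSpace
  have := h.isLocallyFiniteMeasure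
  have := secondCountable_of_proper (α := X)
  have := h.isUnifLocDoublingMeasure
  filter_upwards [IsUnifLocDoublingMeasure.ae_tendsto_average_norm_sub (μ := μ) hu 0] with x hx
  have hδ : Tendsto (fun n : ℕ => 1 / ((n : ℝ) + 1)) atTop (𝓝[>] 0) :=
    tendsto_nhdsWithin_iff.2 ⟨tendsto_one_div_add_atTop_nhds_zero_nat,
      Eventually.of_forall fun n => mem_Ioi.2 (by positivity)⟩
  have h1 := (hx (fun _ => x) _ hδ (Eventually.of_forall fun n => by simp)).const_mul (2 * Cd ^ 2)
  rw [mul_zero] at h1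
  rw [tendsto_iff_dist_tendsto_zero]
  refine squeeze_zero (fun n => dist_nonneg) (fun n => ?_) h1
  rw [Real.dist_eq]
  exact h.abs_smoothing_sub_self_le (by positivity) hu x

/-- The total variation of a bounded function is controlled by its upper gradients. -/
lemma MMS.tv_le_of_isUpperGradientOn (h : MMS μ Cd CP lam)
    (hu : LocallyIntegrable u μ) (hu0 : ∀ y, 0 ≤ u y) (hu1 : ∀ y, u y ≤ 1)
    {g : X → ℝ≥0∞} (hg : Measurable g) (hgu : IsUpperGradientOn g u univ)
    (hfin : ∫⁻ y, g y ∂μ ≠ ⊤) {k : ℕ} (hk : 2 * lam ≤ 2 ^ k) :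
    tv μ u univ ≤ ENNReal.ofReal ((2 * Cd ^ 3 + (2 * Cd ^ 3) ^ 2) * (2 * CP)) *
        (ENNReal.ofReal Cd ^ k * ∫⁻ y, g y ∂μ) := by
  have := h.properSpace
  have := h.isLocallyFiniteMeasure
  have hpos : ∀ n : ℕ, 0 < 1 / ((n : ℝ) + 1) := fun n => by positivity
  choose G hGm hGu hGle using fun n : ℕ =>
    h.exists_isUpperGradientOn_smoothing (hpos n) hu hu0 hu1 hg hgu hfin hk
  have hlip := fun n : ℕ => h.locLipschitzOn_smoothing (hpos n) hu hu0 hu1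
  have hconv : TendstoL1Loc μ (fun n : ℕ => smoothing μ (1 / ((n : ℝ) + 1)) u) u univ := by
    intro K hK _
    have hae := ae_restrict_of_ae (s := K) (h.ae_tendsto_smoothing hu)
    have key := tendsto_lintegral_of_dominated_convergence' (μ := μ.restrict K)
      (F := fun n x => ENNReal.ofReal |smoothing μ (1 / ((n : ℝ) + 1)) u x - u x|)
      (f := fun _ => 0) (fun _ => 1) (fun n => ?_) (fun n => Eventually.of_forall fun x => ?_) ?_ ?_
    · simpa using key
    · exact (measurable_id.abs.comp_aemeasurable ((hlip n).continuous.aemeasurable.sub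
        (hu.integrableOn_isCompact hK).aestronglyMeasurable.aemeasurable)).ennreal_ofReal
    · have h1 := h.smoothing_mem_Icc (hpos n) hu hu0 hu1 x
      refine ENNReal.ofReal_le_one.2 (abs_sub_le_iff.2 ⟨?_, ?_⟩)
      · linarith [h1.2, hu0 x]
      · linarith [h1.1, hu1 x]
    · simpa using hK.measure_lt_top.ne
    · filter_upwards [hae] with x hx
      have := ENNReal.tendsto_ofReal ((hx.sub_const (u x)).abs)
      simpa using this
  refine (tv_le_liminf hlip hconv hGm fun n => (hGu n).isWeakUpperGradientOn).trans ?_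
  refine liminf_le_of_frequently_le' (Eventually.frequently (Eventually.of_forall fun n => ?_))
  rw [setLIntegral_univ]
  exact hGle n

end SmoothingLimit

section Cutoff

variable {x : X} {a b : ℝ}

omit [MeasurableSpace X]

/-- A Lipschitz cutoff function that equals `1` on the ball of radius `a` around `x` and `0`
outside the ball of radius `b`. -/
def cutoff (x : X) (a b : ℝ) (z : X) : ℝ := max 0 (min 1 ((b - dist z x) / (b - a)))

lemma cutoff_nonneg (z : X) : 0 ≤ cutoff x a b z := le_max_left _ _

lemma cutoff_le_one (z : X) : cutoff x a b z ≤ 1 := max_le zero_le_one (min_le_left _ _)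

lemma cutoff_eq_one (hab : a < b) {z : X} (hz : dist z x ≤ a) : cutoff x a b z = 1 := by
  have : 1 ≤ (b - dist z x) / (b - a) := by rw [le_div_iff₀ (by linarith)]; linarith
  rw [cutoff, min_eq_left this, max_eq_right zero_le_one]

lemma cutoff_eq_zero (hab : a < b) {z : X} (hz : b ≤ dist z x) : cutoff x a b z = 0 :=
  max_eq_left ((min_le_right _ _).trans
    (div_nonpos_of_nonpos_of_nonneg (by linarith) (by linarith)))

lemma lipschitzWith_cutoff (hab : a < b) :
    LipschitzWith (1 / (b - a)).toNNReal (cutoff x a b) := by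
  refine LipschitzWith.const_max (LipschitzWith.const_min (LipschitzWith.of_dist_le_mul
    fun y z => ?_) 1) 0
  have hba : 0 < b - a := by linarith
  rw [Real.coe_toNNReal _ (by positivity), Real.dist_eq, ← sub_div, abs_div, abs_of_pos hba,
    div_eq_mul_inv, mul_comm, one_div]
  gcongr
  rw [show b - dist y x - (b - dist z x) = dist z x - dist y x by ring, dist_comm y z]
  exact abs_dist_sub_le _ _ _

lemma eventually_cutoff_eq (hab : a < b) :
    ∀ z ∉ closedBall x b, ∀ᶠ z' in 𝓝 z, cutoff x a b z' = cutoff x a b z := by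
  intro z hz
  filter_upwards [isClosed_closedBall.isOpen_compl.mem_nhds hz] with w hw
  rw [mem_compl_iff, mem_closedBall, not_le] at hw
  rw [mem_closedBall, not_le] at hz
  rw [cutoff_eq_zero hab hw.le, cutoff_eq_zero hab hz.le]

end Cutoff

section Truncation

variable {u : X → ℝ}

omit [MeasurableSpace X] in
lemma IsUpperGradientOn.truncate {g : X → ℝ≥0∞} {Ω : Set X} (hg : IsUpperGradientOn g u Ω) :
    IsUpperGradientOn g (fun z => max 0 (min 1 (u z))) Ω := by
  intro γ hγ
  refine (ENNReal.ofReal_le_ofReal ?_).trans (hg γ hγ)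
  have h : LipschitzWith 1 fun t : ℝ => max 0 (min 1 t) :=
    LipschitzWith.const_max (LipschitzWith.const_min LipschitzWith.id 1) 0
  simpa [Real.dist_eq] using h.dist_le_mul (u (γ.toFun 1)) (u (γ.toFun 0))

omit [MetricSpace X] in
lemma _root_.MeasureTheory.Integrable.truncate {μ : Measure X} (hu : Integrable u μ) :
    Integrable (fun z => max 0 (min 1 (u z))) μ := by
  have hc : Continuous fun t : ℝ => max 0 (min 1 t) := by fun_prop
  refine hu.mono (hc.comp_aestronglyMeasurable hu.aestronglyMeasurable)
    (Eventually.of_forall fun z => ?_)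
  rw [Real.norm_eq_abs, Real.norm_eq_abs, abs_of_nonneg (le_max_left _ _)]
  exact max_le (abs_nonneg _) ((min_le_right _ _).trans (le_abs_self _))

end Truncation

section Energy

variable {μ : Measure X} {Cd CP lam : ℝ}

def sobolevConst (Cd CP : ℝ) : ℝ≥0∞ := (1 + ENNReal.ofReal Cd ^ 4) * ENNReal.ofReal (CP * 5)

def energyConst (Cd CP : ℝ) (k : ℕ) : ℝ≥0∞ :=
  ENNReal.ofReal ((2 * Cd ^ 3 + (2 * Cd ^ 3) ^ 2) * (2 * CP)) * ENNReal.ofReal Cd ^ k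

def massConst (Cd CP : ℝ) (k : ℕ) : ℝ≥0∞ :=
  sobolevConst Cd CP * ((1 + ENNReal.ofReal 4 * sobolevConst Cd CP) * energyConst Cd CP k)

lemma sobolevConst_ne_top : sobolevConst Cd CP ≠ ⊤ :=
  ENNReal.mul_ne_top (by simp) ENNReal.ofReal_ne_top

lemma energyConst_ne_top {k : ℕ} : energyConst Cd CP k ≠ ⊤ :=
  ENNReal.mul_ne_top ENNReal.ofReal_ne_top (by simp)

lemma massConst_ne_top {k : ℕ} : massConst Cd CP k ≠ ⊤ :=
  ENNReal.mul_ne_top sobolevConst_ne_top (ENNReal.mul_ne_top (ENNReal.add_ne_top.2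
    ⟨ENNReal.one_ne_top, ENNReal.mul_ne_top ENNReal.ofReal_ne_top sobolevConst_ne_top⟩)
    energyConst_ne_top)

lemma energyConst_ne_zero (hCd : 1 ≤ Cd) (hCP : 0 < CP) {k : ℕ} : energyConst Cd CP k ≠ 0 := by
  have : 0 < Cd := by linarith
  refine mul_ne_zero ?_ (pow_ne_zero _ ?_)
  · rw [ENNReal.ofReal_ne_zero_iff]; positivity
  · rwa [ENNReal.ofReal_ne_zero_iff]

variable [BorelSpace X]

/-- The Sobolev inequality, in terms of the total variation. -/
lemma MMS.lintegral_abs_le_of_tv_lt (h : MMS μ Cd CP lam) {u : X → ℝ} {c : ℝ≥0∞}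
    (huc : tv μ u univ < c) {x : X} {R : ℝ} (hR : 0 < R)
    (hdiam : ENNReal.ofReal (6 * R) < ediam (univ : Set X))
    (hu : ∀ᵐ y ∂μ, y ∉ ball x (2 * R) → u y = 0) :
    ∫⁻ y, ENNReal.ofReal |u y| ∂μ ≤ sobolevConst Cd CP * (ENNReal.ofReal R * c) := by
  obtain ⟨v, G, hv⟩ := exists_approximates_of_tv_lt huc
  refine (hv.lintegral_abs_le h hR hdiam hu).trans_eq ?_
  rw [← mul_assoc CP, ENNReal.ofReal_mul (by have := h.hCP; positivity), sobolevConst]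
  ring

/-- Cutting off a function at scale `R` increases its total variation by a bounded factor. -/
lemma MMS.tv_cutoff_mul_le (h : MMS μ Cd CP lam) {u : X → ℝ} {c : ℝ≥0∞}
    (huc : tv μ u univ < c) (hc : c ≠ ⊤) (hum : AEMeasurable u μ) {x : X} {R : ℝ} (hR : 0 < R)
    (hdiam : ENNReal.ofReal (6 * R) < ediam (univ : Set X))
    (hu : ∀ᵐ y ∂μ, y ∉ ball x (2 * R) → u y = 0) :
    tv μ (fun z => cutoff x R (5 * R / 4) z * u z) univ ≤
      (1 + ENNReal.ofReal 4 * sobolevConst Cd CP) * c := by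
  have := h.properSpace
  have hlt : R < 5 * R / 4 := by linarith
  obtain ⟨v, G, hv⟩ := exists_approximates_of_tv_lt huc
  refine (hv.tv_mul_cutoff_le_add hc hum (lipschitzWith_cutoff hlt) cutoff_nonneg cutoff_le_one
    (isCompact_closedBall x _) (eventually_cutoff_eq hlt)).trans ?_
  have hL : ENNReal.ofReal (1 / (5 * R / 4 - R)) * ENNReal.ofReal R = ENNReal.ofReal 4 := by
    rw [← ENNReal.ofReal_mul (by rw [one_div_nonneg]; linarith)]
    congr 1
    field_simp
    norm_num
  calc _ ≤ c + ENNReal.ofReal (1 / (5 * R / 4 - R)) *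
        (sobolevConst Cd CP * (ENNReal.ofReal R * c)) := by
        gcongr
        · exact le_rfl
        · exact (setLIntegral_le_lintegral _ _).trans
            (h.lintegral_abs_le_of_tv_lt huc hR hdiam hu)
    _ = c + (ENNReal.ofReal (1 / (5 * R / 4 - R)) * ENNReal.ofReal R) * sobolevConst Cd CP * c := by
        ring
    _ = _ := by rw [hL]; ring

/-- Solutions of the obstacle problem have finite total variation and small measure, controlled
by the energy of any admissible function for the capacity. -/
lemma MMS.tv_measure_le_of_isObstacleSolution (h : MMS μ Cd CP lam) {x : X} {R : ℝ} (hR : 0 < R)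
    (hdiam : ENNReal.ofReal (6 * R) < ediam (univ : Set X)) {A F : Set X} (hA : A ⊆ ball x R)
    (hFm : MeasurableSet F)
    (hF : IsObstacleSolution μ (fun y => ((chi A y : ℝ) : EReal)) (fun _ => (0 : ℝ))
      (ball x (3 * R / 2)) (chi F))
    {u : X → ℝ} (hu : Integrable u μ) (hu1 : ∀ z ∈ A, 1 ≤ u z)
    (hu0 : ∀ z ∈ (ball x (2 * R))ᶜ, u z = 0) {g : X → ℝ≥0∞} (hg : Measurable g)
    (hgu : IsUpperGradientOn g u univ) {b : ℝ≥0∞} (hgb : ∫⁻ y, g y ∂μ < b)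
    {k : ℕ} (hk : 2 * lam ≤ 2 ^ k) :
    tv μ (chi F) univ < ⊤ ∧ μ F ≤ massConst Cd CP k * (ENNReal.ofReal R * b) := by
  set u₀ : X → ℝ := fun z => max 0 (min 1 (u z)) with hu₀
  have hi₀ : Integrable u₀ μ := hu.truncate
  have hz₀ : ∀ y, y ∉ ball x (2 * R) → u₀ y = 0 := fun y hy => by simp [hu₀, hu0 y hy]
  have hK0 : energyConst Cd CP k ≠ 0 := energyConst_ne_zero h.hCd h.hCP
  have htv : tv μ u₀ univ < energyConst Cd CP k * b :=
    (h.tv_le_of_isUpperGradientOn hi₀.locallyIntegrable (fun y => le_max_left _ _)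
      (fun y => max_le zero_le_one (min_le_left _ _)) hg hgu.truncate hgb.ne_top hk).trans_lt
      (by rw [← mul_assoc]; exact (ENNReal.mul_lt_mul_iff_right hK0 energyConst_ne_top).2 hgb)
  obtain ⟨c, hc1, hc2⟩ := exists_between htv
  set D : ℝ≥0∞ := 1 + ENNReal.ofReal 4 * sobolevConst Cd CP with hD
  have hDtop : D ≠ ⊤ := ENNReal.add_ne_top.2
    ⟨ENNReal.one_ne_top, ENNReal.mul_ne_top ENNReal.ofReal_ne_top sobolevConst_ne_top⟩
  have hD0 : D ≠ 0 := by simp [hD]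
  have hcomp := h.tv_cutoff_mul_le hc1 hc2.ne_top hi₀.aestronglyMeasurable.aemeasurable hR hdiam
    (Eventually.of_forall hz₀)
  have hlt : R < 5 * R / 4 := by linarith
  have hmem : MemK μ (fun y => ((chi A y : ℝ) : EReal)) (fun _ => (0 : ℝ)) (ball x (3 * R / 2))
      (fun z => cutoff x R (5 * R / 4) z * u₀ z) := by
    refine ⟨fun K _ _ => ⟨univ, isOpen_univ, subset_univ _, Subset.rfl, ?_,
      hcomp.trans_lt (ENNReal.mul_lt_top hDtop.lt_top hc2.ne_top.lt_top)⟩,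
      Eventually.of_forall fun z _ => ?_, Eventually.of_forall fun z hz => ?_⟩
    · exact (hi₀.bdd_mul (c := 1) (lipschitzWith_cutoff hlt).continuous.aestronglyMeasurable
        (Eventually.of_forall fun z => by
          rw [Real.norm_eq_abs, abs_of_nonneg (cutoff_nonneg z)]
          exact cutoff_le_one z)).integrableOn
    · rw [EReal.coe_le_coe_iff]
      beta_reduce
      by_cases hz : z ∈ A
      · rw [chi, indicator_of_mem hz, cutoff_eq_one hlt (mem_ball.1 (hA hz)).le, one_mul]
        exact le_max_of_le_right (le_min le_rfl (hu1 z hz))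
      · rw [chi, indicator_of_notMem hz]
        exact mul_nonneg (cutoff_nonneg z) (le_max_left _ _)
    · rw [mem_ball, not_lt] at hz
      beta_reduce
      rw [cutoff_eq_zero hlt (by linarith), zero_mul]
  have htvF : tv μ (chi F) univ < D * (energyConst Cd CP k * b) :=
    ((hF.2 _ hmem).trans hcomp).trans_lt ((ENNReal.mul_lt_mul_iff_right hD0 hDtop).2 hc2)
  refine ⟨htvF.trans_le le_top, ?_⟩
  have hS := h.lintegral_abs_le_of_tv_lt htvF hR hdiam (x := x) (by
    filter_upwards [hF.1.2.2] with z hz hzR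
    exact hz fun hz' => hzR (ball_subset_ball (by linarith) hz'))
  have hmF : ∫⁻ y, ENNReal.ofReal |chi F y| ∂μ = μ F := by
    rw [← lintegral_indicator_one hFm]
    refine lintegral_congr fun y => ?_
    by_cases hy : y ∈ F <;> simp [chi, hy]
  rw [hmF] at hS
  refine hS.trans_eq ?_
  rw [massConst]
  ring

omit [BorelSpace X] in
lemma MemK.congr_ae {ψ : X → EReal} {f u u' : X → ℝ} {Ω : Set X} (h : MemK μ ψ f Ω u)
    (hu : u =ᵐ[μ] u') : MemK μ ψ f Ω u' := by
  refine ⟨fun K hK hKu => ?_, ?_, ?_⟩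
  · obtain ⟨U, hU, hKU, hU', hI, ht⟩ := h.1 K hK hKu
    exact ⟨U, hU, hKU, hU', hI.congr (ae_restrict_of_ae hu), by rwa [← tv_congr_ae hu]⟩
  · filter_upwards [h.2.1, hu] with z hz hz' hzΩ
    rw [← hz']
    exact hz hzΩ
  · filter_upwards [h.2.2, hu] with z hz hz' hzΩ
    rw [← hz']
    exact hz hzΩ

omit [BorelSpace X] in
lemma IsObstacleSolution.congr_ae {ψ : X → EReal} {f u u' : X → ℝ} {Ω : Set X}
    (h : IsObstacleSolution μ ψ f Ω u) (hu : u =ᵐ[μ] u') : IsObstacleSolution μ ψ f Ω u' :=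
  ⟨h.1.congr_ae hu, fun v hv => by rw [← tv_congr_ae hu]; exact h.2 v hv⟩

/-- A set whose characteristic function is admissible for an obstacle problem is measurable up to
a null set. -/
lemma MemK.nullMeasurableSet [ProperSpace X] {ψ : X → EReal} {E : Set X} {x : X} {r : ℝ}
    (h : MemK μ ψ (fun _ => 0) (ball x r) (chi E)) : NullMeasurableSet E μ := by
  obtain ⟨U, _, hKU, _, hI, _⟩ := h.1 (closedBall x r) (isCompact_closedBall x r) (subset_univ _)
  have h1 : AEMeasurable ((closedBall x r).indicator (chi E)) μ :=
    (aemeasurable_indicator_iff measurableSet_closedBall).2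
      (hI.mono_set hKU).aestronglyMeasurable.aemeasurable
  refine (aemeasurable_indicator_const_iff (1 : ℝ)).1 (h1.congr ?_)
  filter_upwards [h.2.2] with z hz
  by_cases hzK : z ∈ closedBall x r
  · rw [indicator_of_mem hzK, chi]
  · rw [indicator_of_notMem hzK]
    exact (hz fun hz' => hzK (ball_subset_closedBall hz')).symm

end Energy

section Decay

variable {μ : Measure X} {Cd CP lam : ℝ} [BorelSpace X]

/-- Relative isoperimetric inequality at small scales: a set whose density at scale `s` is at
most one half near `y` is controlled by near-optimal upper gradients. -/
lemma Approximates.measure_inter_ball_le (h : MMS μ Cd CP lam) {F : Set X} (hF : MeasurableSet F)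
    {v : ℕ → X → ℝ} {G : ℕ → X → ℝ≥0∞} {c : ℝ≥0∞} (hv : Approximates μ v G (chi F) c)
    {y : X} {r s : ℝ} (hs : 0 < s) (hsr : (1 + lam) * s ≤ r / 8)
    (hhalf : ∀ z, dist z y < 5 * r / 8 → μ (F ∩ ball z s) ≤ μ (ball z s \ F))
    {k : ℕ} (hk : 2 * lam ≤ 2 ^ k) (i : ℕ) :
    μ (F ∩ ball y (r / 2)) ≤ ENNReal.ofReal Cd *
      (ENNReal.ofReal Cd * ∫⁻ z in ball y (3 * r / 4), ENNReal.ofReal |v i z - chi F z| ∂μ +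
        ENNReal.ofReal (CP * s) * (ENNReal.ofReal Cd ^ k * ∫⁻ z in ball y (3 * r / 4), G i z ∂μ))
      := by
  have := h.properSpace
  have := secondCountable_of_proper (α := X)
  have := h.isLocallyFiniteMeasure
  have hls : s ≤ lam * s := le_mul_of_one_le_left hs.le h.hlam
  set B := ball y (3 * r / 4) with hB
  set f : X → ℝ≥0∞ := B.indicator fun z => ENNReal.ofReal |v i z - chi F z| with hf
  set g : X → ℝ≥0∞ := B.indicator (G i) with hg
  have hchi : Measurable (chi F) := measurable_const.indicator hF
  have hfm : Measurable f := by
    refine Measurable.indicator ?_ measurableSet_ball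
    exact (((hv.locLipschitz i).continuous.measurable.sub hchi).norm).ennreal_ofReal
  have hgm : Measurable g := (hv.measurable i).indicator measurableSet_ball
  have hpt : ∀ z, μ (F ∩ ball y (r / 2) ∩ ball z s) / μ (ball z s) ≤
      (∫⁻ w in ball z s, f w ∂μ) / μ (ball z s) +
        ENNReal.ofReal (CP * s) * ((∫⁻ w in ball z (lam * s), g w ∂μ) / μ (ball z s)) := by
    intro z
    rcases (F ∩ ball y (r / 2) ∩ ball z s).eq_empty_or_nonempty with hemp | ⟨p, ⟨_, hp⟩, hpz⟩
    · rw [hemp, measure_empty, ENNReal.zero_div]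
      exact bot_le
    · have hzy : dist z y < r / 2 + s := by
        rw [mem_ball] at hp
        rw [mem_ball'] at hpz
        linarith [dist_triangle z p y]
      have hsub : ball z (lam * s) ⊆ B := ball_subset_ball' (by linarith)
      have hsub' : ball z s ⊆ B := (ball_subset_ball hls).trans hsub
      obtain ⟨d, hd⟩ := hv.exists_lintegral_abs_sub_le h z hs i
      have h1 := (measure_inter_le_lintegral_abs_chi_sub hF (hhalf z (by linarith)) d).trans hd
      rw [← mul_div_assoc, ← ENNReal.add_div]
      gcongr
      calc μ (F ∩ ball y (r / 2) ∩ ball z s) ≤ μ (F ∩ ball z s) := by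
            gcongr
            exact inter_subset_left
        _ ≤ _ := h1
        _ = _ := by
            congr 1
            · exact setLIntegral_congr_fun measurableSet_ball fun w hw => by
                rw [hf, indicator_of_mem (hsub' hw)]
            · congr 1
              exact setLIntegral_congr_fun measurableSet_ball fun w hw => by
                rw [hg, indicator_of_mem (hsub hw)]
  refine (h.measure_le_lintegral_ball_div (hF.inter measurableSet_ball) hs).trans ?_
  gcongr
  have hm1 : Measurable fun z => (∫⁻ w in ball z s, f w ∂μ) / μ (ball z s) :=
    (measurable_lintegral_ball hfm s).div (measurable_measure_ball s)
  have hm2 : Measurable fun z => (∫⁻ w in ball z (lam * s), g w ∂μ) / μ (ball z s) :=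
    (measurable_lintegral_ball hgm _).div (measurable_measure_ball s)
  refine (lintegral_mono hpt).trans ?_
  rw [lintegral_add_left hm1, lintegral_const_mul _ hm2]
  gcongr
  · refine (h.lintegral_ball_div_le hfm hs (k := 1) (by linarith)).trans_eq ?_
    rw [pow_one, hf, lintegral_indicator measurableSet_ball]
  · refine (h.lintegral_ball_div_le hgm hs (k := k) ?_).trans_eq ?_
    · rw [← mul_assoc]
      gcongr
    · rw [hg, lintegral_indicator measurableSet_ball]

/-- Decay of the measure in a smaller ball, for sets that cannot decrease their perimeter by
cutting away a ball. -/
lemma MMS.measure_inter_ball_half_le (h : MMS μ Cd CP lam) {F : Set X} (hF : MeasurableSet F)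
    (htop : tv μ (chi F) univ ≠ ⊤) {y : X} {r τ : ℝ} (hr : 0 < r) (hτ : 0 < τ)
    (hτlam : (1 + lam) * τ ≤ 1 / 8) {k k' : ℕ} (hk : 2 * lam ≤ 2 ^ k) (hk' : 2 ≤ 2 ^ k' * τ)
    (hmin : tv μ (chi F) univ ≤
      tv μ (fun z => (1 - cutoff y (3 * r / 4) (7 * r / 8) z) * chi F z) univ)
    (hdens : 2 * ENNReal.ofReal Cd ^ k' * μ (F ∩ ball y r) ≤ μ (ball y r)) :
    μ (F ∩ ball y (r / 2)) ≤
      ENNReal.ofReal Cd ^ (k + 1) * ENNReal.ofReal (8 * CP * τ) * μ (F ∩ ball y r) := by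
  have := h.properSpace
  have := h.isLocallyFiniteMeasure
  have hCP := h.hCP
  have hCd1 := h.one_le_ofReal_Cd
  have hCd0 : ENNReal.ofReal Cd ≠ 0 := (one_pos.trans_le hCd1).ne'
  have hs : 0 < τ * r := mul_pos hτ hr
  have hsr : (1 + lam) * (τ * r) ≤ r / 8 := by nlinarith
  have hls : τ * r ≤ lam * (τ * r) := le_mul_of_one_le_left hs.le h.hlam
  have hlt : 3 * r / 4 < 7 * r / 8 := by linarith
  have hhalf : ∀ z, dist z y < 5 * r / 8 → μ (F ∩ ball z (τ * r)) ≤ μ (ball z (τ * r) \ F) := by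
    intro z hz
    have hfin : μ (F ∩ ball z (τ * r)) ≠ ⊤ :=
      ((measure_mono inter_subset_right).trans_lt (h.ball_lt_top z _)).ne
    have h1 : μ (F ∩ ball z (τ * r)) ≤ μ (F ∩ ball y r) := by
      gcongr
      exact ball_subset_ball' (by linarith)
    have h2 : μ (ball y r) ≤ ENNReal.ofReal Cd ^ k' * μ (ball z (τ * r)) :=
      h.ball_le_ball hs k' (by rw [dist_comm y z, ← mul_assoc]; nlinarith)
    have h3 : ENNReal.ofReal Cd ^ k' * (2 * μ (F ∩ ball z (τ * r))) ≤
        ENNReal.ofReal Cd ^ k' * μ (ball z (τ * r)) := by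
      calc _ = 2 * ENNReal.ofReal Cd ^ k' * μ (F ∩ ball z (τ * r)) := by ring
        _ ≤ 2 * ENNReal.ofReal Cd ^ k' * μ (F ∩ ball y r) := by gcongr
        _ ≤ _ := hdens.trans h2
    rw [ENNReal.mul_le_mul_iff_right (pow_ne_zero _ hCd0) (by simp), two_mul,
      ← measure_inter_add_sdiff (ball z (τ * r)) hF, inter_comm (ball z _)] at h3
    exact (ENNReal.add_le_add_iff_left hfin).1 h3
  set L : ℝ≥0∞ := ENNReal.ofReal (1 / (7 * r / 8 - 3 * r / 4)) with hL
  set M : ℝ≥0∞ := ENNReal.ofReal Cd * (ENNReal.ofReal Cd +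
    ENNReal.ofReal (CP * (τ * r)) * (ENNReal.ofReal Cd ^ k * (L + 2))) with hM
  have hMtop : M ≠ ⊤ := by
    refine ENNReal.mul_ne_top ENNReal.ofReal_ne_top (ENNReal.add_ne_top.2
      ⟨ENNReal.ofReal_ne_top, ENNReal.mul_ne_top ENNReal.ofReal_ne_top
        (ENNReal.mul_ne_top (by simp) (by simp [hL]))⟩)
  have hM0 : M ≠ 0 := mul_ne_zero hCd0 (by simp [hCd0, -ENNReal.ofReal_eq_zero])
  refine ENNReal.le_of_forall_pos_le_add fun ε hε _ => ?_
  set ε' : ℝ≥0∞ := ε / M with hε'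
  have hε'0 : ε' ≠ 0 := by simp [hε', ENNReal.div_eq_zero_iff, hε.ne', hMtop]
  have hε'top : ε' ≠ ⊤ := ENNReal.div_ne_top ENNReal.coe_ne_top hM0
  obtain ⟨v, G, hv⟩ := exists_approximates_of_tv_lt (ENNReal.lt_add_right htop hε'0)
  have hchi : Measurable (chi F) := measurable_const.indicator hF
  have hev := hv.eventually_lintegral_le htop hε'0 hε'top hchi.aemeasurable
    (lipschitzWith_cutoff hlt) cutoff_nonneg cutoff_le_one (isCompact_closedBall y _)
    (eventually_cutoff_eq hlt) hmin
  have hev' := (hv.tendsto (closedBall y r) (isCompact_closedBall y r)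
    (subset_univ _)).eventually_lt_const (pos_iff_ne_zero.2 hε'0)
  obtain ⟨i, hi, hi'⟩ := (hev.and hev').exists
  have hmass : ∫⁻ z in closedBall y (7 * r / 8), ENNReal.ofReal |chi F z| ∂μ ≤
      μ (F ∩ ball y r) := by
    calc _ ≤ ∫⁻ z in ball y r, ENNReal.ofReal |chi F z| ∂μ :=
          lintegral_mono_set (closedBall_subset_ball (by linarith))
      _ = ∫⁻ z in ball y r, F.indicator 1 z ∂μ := by
          refine lintegral_congr fun z => ?_
          by_cases hz : z ∈ F <;> simp [chi, hz]
      _ = _ := by rw [lintegral_indicator_one hF, Measure.restrict_apply hF]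
  have hG : ∫⁻ z in ball y (3 * r / 4), G i z ∂μ ≤ L * μ (F ∩ ball y r) + (L + 2) * ε' := by
    calc _ = ∫⁻ z in ball y (3 * r / 4),
          ENNReal.ofReal (cutoff y (3 * r / 4) (7 * r / 8) z) * G i z ∂μ := by
          refine setLIntegral_congr_fun measurableSet_ball fun z hz => ?_
          rw [cutoff_eq_one hlt (mem_ball.1 hz).le, ENNReal.ofReal_one, one_mul]
      _ ≤ _ := setLIntegral_le_lintegral _ _
      _ ≤ _ := hi
      _ ≤ _ := by gcongr <;> exact le_rfl
  have hLτ : L * ENNReal.ofReal (CP * (τ * r)) = ENNReal.ofReal (8 * CP * τ) := by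
    rw [hL, ← ENNReal.ofReal_mul (by rw [one_div_nonneg]; linarith)]
    congr 1
    field_simp
    norm_num
  calc _ ≤ _ := hv.measure_inter_ball_le h hF hs hsr hhalf hk i
    _ ≤ ENNReal.ofReal Cd * (ENNReal.ofReal Cd * ε' + ENNReal.ofReal (CP * (τ * r)) *
        (ENNReal.ofReal Cd ^ k * (L * μ (F ∩ ball y r) + (L + 2) * ε'))) := by
        gcongr
        exact (lintegral_mono_set ((ball_subset_ball (by linarith)).trans
          ball_subset_closedBall)).trans hi'.le
    _ = ENNReal.ofReal Cd ^ (k + 1) * (L * ENNReal.ofReal (CP * (τ * r))) * μ (F ∩ ball y r) +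
        M * ε' := by rw [hM]; ring
    _ = _ := by rw [hLτ, hε', ENNReal.mul_div_cancel hM0 hMtop]

omit [BorelSpace X] in
/-- Geometric decay of the density at a point, from geometric decay of the measure. -/
lemma MMS.tendsto_density_zero (h : MMS μ Cd CP lam) {F : Set X} {y : X} {r₀ : ℝ} (hr₀ : 0 < r₀)
    {δ : ℝ≥0∞} (hδ : 1 ≤ δ) (h0 : δ * μ (F ∩ ball y r₀) ≤ μ (ball y r₀))
    (hstep : ∀ r, 0 < r → r ≤ r₀ → δ * μ (F ∩ ball y r) ≤ μ (ball y r) →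
      2 * ENNReal.ofReal Cd * μ (F ∩ ball y (r / 2)) ≤ μ (F ∩ ball y r)) :
    Tendsto (fun r : ℝ => μ (F ∩ ball y r) / μ (ball y r)) (𝓝[>] (0 : ℝ)) (𝓝 0) := by
  have hCd1 := h.one_le_ofReal_Cd
  have hCd0 : ENNReal.ofReal Cd ≠ 0 := (one_pos.trans_le hCd1).ne'
  have hpos : ∀ n : ℕ, 0 < r₀ * (1 / 2) ^ n := fun n => by positivity
  have hle : ∀ n : ℕ, r₀ * (1 / 2) ^ n ≤ r₀ := fun n =>
    mul_le_of_le_one_right hr₀.le (pow_le_one₀ (by norm_num) (by norm_num))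
  have hhalf : ∀ n : ℕ, r₀ * (1 / 2) ^ (n + 1) = r₀ * (1 / 2) ^ n / 2 := fun n => by ring
  have key : ∀ n : ℕ, 2 ^ n * (δ * μ (F ∩ ball y (r₀ * (1 / 2) ^ n))) ≤
      μ (ball y (r₀ * (1 / 2) ^ n)) := by
    intro n
    induction n with
    | zero => simpa using h0
    | succ n ih =>
      have h1 := hstep _ (hpos n) (hle n) ((le_mul_of_one_le_left bot_le
        (one_le_pow₀ one_le_two)).trans ih)
      have h2 := (h.doubling y (r₀ * (1 / 2) ^ n / 2) (by have := hpos n; positivity)).2.1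
      rw [mul_div_cancel₀ _ two_ne_zero] at h2
      rw [← hhalf] at h1 h2
      rw [← ENNReal.mul_le_mul_iff_right hCd0 ENNReal.ofReal_ne_top]
      calc _ = 2 ^ n * (δ * (2 * ENNReal.ofReal Cd * μ (F ∩ ball y (r₀ * (1 / 2) ^ (n + 1))))) := by
            ring
        _ ≤ 2 ^ n * (δ * μ (F ∩ ball y (r₀ * (1 / 2) ^ n))) := by gcongr
        _ ≤ _ := ih.trans h2
  have hlim : Tendsto (fun r : ℝ => ENNReal.ofReal (Cd * (2 / r₀) * r)) (𝓝[>] 0) (𝓝 0) := by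
    have : Tendsto (fun r : ℝ => Cd * (2 / r₀) * r) (𝓝[>] 0) (𝓝 (Cd * (2 / r₀) * 0)) :=
      (tendsto_id.const_mul _).mono_left nhdsWithin_le_nhds
    simpa using ENNReal.tendsto_ofReal this
  refine tendsto_of_tendsto_of_tendsto_of_le_of_le' tendsto_const_nhds hlim
    (Eventually.of_forall fun r => bot_le) ?_
  filter_upwards [Ioo_mem_nhdsGT hr₀] with r hr
  obtain ⟨n, hn1, hn2⟩ := exists_nat_pow_near_of_lt_one (x := r / r₀) (y := (1 / 2 : ℝ))
    (div_pos hr.1 hr₀) ((div_le_one hr₀).2 hr.2.le) (by norm_num) (by norm_num)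
  rw [lt_div_iff₀ hr₀, mul_comm] at hn1
  rw [div_le_iff₀ hr₀, mul_comm] at hn2
  refine ENNReal.div_le_of_le_mul ?_
  have h2n : (2 : ℝ≥0∞) ^ n ≠ 0 := by simp
  have h2n' : (2 : ℝ≥0∞) ^ n ≠ ⊤ := by simp
  rw [← ENNReal.mul_le_mul_iff_right h2n h2n']
  calc 2 ^ n * μ (F ∩ ball y r) ≤ 2 ^ n * (δ * μ (F ∩ ball y (r₀ * (1 / 2) ^ n))) := by
        gcongr
        exact (measure_mono (inter_subset_inter_right _ (ball_subset_ball hn2))).trans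
          (le_mul_of_one_le_left bot_le hδ)
    _ ≤ _ := key n
    _ ≤ ENNReal.ofReal Cd * μ (ball y r) := by
        have h2 := (h.doubling y (r₀ * (1 / 2) ^ n / 2) (by have := hpos n; positivity)).2.1
        rw [mul_div_cancel₀ _ two_ne_zero] at h2
        refine h2.trans ?_
        gcongr
        rw [← hhalf]
        exact hn1.le
    _ ≤ 2 ^ n * ENNReal.ofReal (Cd * (2 / r₀) * r) * μ (ball y r) := by
        gcongr
        rw [show (2 : ℝ≥0∞) ^ n = ENNReal.ofReal (2 ^ n) by
          rw [ENNReal.ofReal_pow (by norm_num)]; norm_num, ← ENNReal.ofReal_mul (by positivity)]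
        apply ENNReal.ofReal_le_ofReal
        have hCd : 0 ≤ Cd := by linarith [h.hCd]
        have h1 : 1 ≤ 2 ^ n * (2 / r₀ * r) := by
          have h3 : (2 : ℝ) ^ n * (1 / 2) ^ (n + 1) = 1 / 2 := by
            rw [pow_succ, ← mul_assoc, ← mul_pow]; norm_num
          have h4 : (2 : ℝ) ^ n * (2 / r₀ * (r₀ * (1 / 2) ^ (n + 1))) = 1 := by
            rw [show (2 : ℝ) ^ n * (2 / r₀ * (r₀ * (1 / 2) ^ (n + 1))) =
              2 * (2 ^ n * (1 / 2) ^ (n + 1)) by field_simp, h3]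
            norm_num
          rw [← h4]
          gcongr
        nlinarith
    _ = _ := by ring

end Decay

section Main

variable {μ : Measure X} {Cd CP lam : ℝ} [BorelSpace X]

/-- Removing a set away from the obstacle does not decrease the total variation of a solution. -/
lemma IsObstacleSolution.tv_le_tv_one_sub_mul {A F Ω : Set X} (hFm : MeasurableSet F)
    (hF : IsObstacleSolution μ (fun z => ((chi A z : ℝ) : EReal)) (fun _ => (0 : ℝ)) Ω (chi F))
    (hfin : μ F ≠ ⊤) {φ : X → ℝ} (hφ : Continuous φ) (hφ0 : ∀ z, 0 ≤ φ z) (hφ1 : ∀ z, φ z ≤ 1)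
    (hφA : ∀ z ∈ A, φ z = 0) :
    tv μ (chi F) univ ≤ tv μ (fun z => (1 - φ z) * chi F z) univ := by
  by_cases htop : tv μ (fun z => (1 - φ z) * chi F z) univ = ⊤
  · rw [htop]
    exact le_top
  refine hF.2 _ ⟨fun K _ _ => ⟨univ, isOpen_univ, subset_univ _, Subset.rfl, ?_,
    lt_top_iff_ne_top.2 htop⟩, ?_, ?_⟩
  · have hi : Integrable (chi F) μ := (integrable_indicator_iff hFm).2 (integrableOn_const hfin)
    refine (hi.bdd_mul (c := 1) (continuous_const.sub hφ).aestronglyMeasurable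
      (Eventually.of_forall fun z => ?_)).integrableOn
    change |1 - φ z| ≤ 1
    rw [abs_of_nonneg (sub_nonneg.2 (hφ1 z))]
    linarith [hφ0 z]
  · filter_upwards [hF.1.2.1] with z hz hzΩ
    by_cases hzA : z ∈ A
    · simpa [hφA z hzA] using hz hzΩ
    · rw [EReal.coe_le_coe_iff, chi, indicator_of_notMem hzA]
      exact mul_nonneg (sub_nonneg.2 (hφ1 z)) (indicator_nonneg (fun _ _ => zero_le_one) z)
  · filter_upwards [hF.1.2.2] with z hz hzΩ
    rw [hz hzΩ, mul_zero]

lemma exists_scale (hCd : 1 ≤ Cd) (hCP : 0 < CP) (hlam : 1 ≤ lam) (k : ℕ) :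
    ∃ (τ : ℝ) (k' : ℕ), 0 < τ ∧ (1 + lam) * τ ≤ 1 / 8 ∧ 2 ≤ 2 ^ k' * τ ∧
      2 * ENNReal.ofReal Cd * (ENNReal.ofReal Cd ^ (k + 1) * ENNReal.ofReal (8 * CP * τ)) ≤ 1 := by
  set D : ℝ := 8 * (1 + lam) + 16 * CP * Cd ^ (k + 2) with hD
  have hCd0 : 0 < Cd := by linarith
  have h1 : 0 ≤ 16 * CP * Cd ^ (k + 2) := by positivity
  have h2 : 0 < 8 * (1 + lam) := by linarith
  have hD0 : 0 < D := by linarith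
  obtain ⟨k', hk'⟩ := pow_unbounded_of_one_lt (2 * D) one_lt_two
  refine ⟨1 / D, k', by positivity, ?_, ?_, ?_⟩
  · rw [mul_one_div, div_le_iff₀ hD0]
    linarith
  · rw [mul_one_div, le_div_iff₀ hD0]
    exact hk'.le
  · rw [show (2 : ℝ≥0∞) = ENNReal.ofReal 2 by norm_num, ← ENNReal.ofReal_pow hCd0.le,
      ← ENNReal.ofReal_mul (by positivity), ← ENNReal.ofReal_mul (by positivity),
      ← ENNReal.ofReal_mul (by positivity)]
    refine ENNReal.ofReal_le_one.2 ?_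
    rw [show 2 * Cd * (Cd ^ (k + 1) * (8 * CP * (1 / D))) = 16 * CP * Cd ^ (k + 2) / D by ring,
      div_le_one hD0]
    linarith

omit [BorelSpace X] in
lemma upperApprox_chi_le_zero {E F : Set X} {y : X} (hEF : E ⊆ F)
    (h : Tendsto (fun r : ℝ => μ (F ∩ ball y r) / μ (ball y r)) (𝓝[>] (0 : ℝ)) (𝓝 0)) :
    upperApprox μ (chi E) y ≤ 0 := by
  refine sInf_le ⟨0, ?_, EReal.coe_zero⟩
  refine tendsto_of_tendsto_of_tendsto_of_le_of_le tendsto_const_nhds h (fun r => bot_le)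
    fun r => ?_
  beta_reduce
  gcongr
  intro z hz
  refine hEF ?_
  by_contra hzE
  simp [chi, hzE] at hz

omit [BorelSpace X] in
lemma upperApprox_chi_le_one {E : Set X} {y : X} : upperApprox μ (chi E) y ≤ 1 := by
  refine sInf_le ⟨1, ?_, EReal.coe_one⟩
  have : {z | 1 < chi E z} = ∅ := by
    ext z
    by_cases hz : z ∈ E <;> simp [chi, hz]
  simp [this]

omit [BorelSpace X] in
/-- If the capacity is small, some admissible function has a genuine upper gradient of small
energy. -/
lemma exists_of_vcap1_lt {A Ω : Set X} {b : ℝ≥0∞} (h : vcap1 μ A Ω < b) :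
    ∃ (u : X → ℝ) (g : X → ℝ≥0∞), Integrable u μ ∧ (∀ z ∈ A, 1 ≤ u z) ∧ (∀ z ∈ Ωᶜ, u z = 0) ∧
      Measurable g ∧ IsUpperGradientOn g u univ ∧ ∫⁻ z, g z ∂μ < b := by
  simp only [vcap1, iInf_lt_iff] at h
  obtain ⟨u, hu, hu1, hu0, g, hg, hgu, hb⟩ := h
  obtain ⟨b', hb1, hb2⟩ := exists_between hb
  obtain ⟨g', hg', hgu', hle⟩ := hgu.exists_isUpperGradientOn hg (tsub_pos_of_lt hb1).ne'
  refine ⟨u, g', hu.1, hu1, hu0, hg', hgu', hle.trans_lt ?_⟩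
  rwa [add_tsub_cancel_of_le hb1.le]

/-- A solution of small measure has density zero at points of the annulus. -/
lemma MMS.tendsto_density_zero_of_isObstacleSolution (h : MMS μ Cd CP lam) {x y : X} {R : ℝ}
    (hR : 0 < R) {A F Ω : Set X}
    (hA' : A ∩ (ball x (9 * R / 20) \ ball x (R / 4)) = ∅) (hFm : MeasurableSet F)
    (hF : IsObstacleSolution μ (fun z => ((chi A z : ℝ) : EReal)) (fun _ => (0 : ℝ)) Ω (chi F))
    (htv : tv μ (chi F) univ < ⊤) (hfin : μ F ≠ ⊤)
    (hy1 : 5 * R / 16 ≤ dist x y) (hy2 : dist x y < 2 * R / 5)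
    {τ : ℝ} {k k' : ℕ} (hτ : 0 < τ) (hτlam : (1 + lam) * τ ≤ 1 / 8) (hk : 2 * lam ≤ 2 ^ k)
    (hk' : 2 ≤ 2 ^ k' * τ)
    (hdecay : 2 * ENNReal.ofReal Cd *
      (ENNReal.ofReal Cd ^ (k + 1) * ENNReal.ofReal (8 * CP * τ)) ≤ 1)
    (hsmall : ENNReal.ofReal Cd ^ 5 * (2 * ENNReal.ofReal Cd ^ k' * μ F) ≤ μ (ball x R)) :
    Tendsto (fun r : ℝ => μ (F ∩ ball y r) / μ (ball y r)) (𝓝[>] (0 : ℝ)) (𝓝 0) := by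
  have hCd1 := h.one_le_ofReal_Cd
  have hCd0 : ENNReal.ofReal Cd ≠ 0 := (one_pos.trans_le hCd1).ne'
  have hr₀ : 0 < R / 20 := by linarith
  refine h.tendsto_density_zero hr₀ (δ := 2 * ENNReal.ofReal Cd ^ k')
    (one_le_two.trans (le_mul_of_one_le_right bot_le (one_le_pow₀ hCd1))) ?_ ?_
  · rw [← ENNReal.mul_le_mul_iff_right (pow_ne_zero 5 hCd0) (by simp)]
    calc _ ≤ ENNReal.ofReal Cd ^ 5 * (2 * ENNReal.ofReal Cd ^ k' * μ F) := by
          gcongr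
          exact inter_subset_left
      _ ≤ _ := hsmall.trans (h.ball_le_ball hr₀ 5 (by linarith))
  · intro r hr hr' hdens
    have hlt : 3 * r / 4 < 7 * r / 8 := by linarith
    have hmin := hF.tv_le_tv_one_sub_mul hFm hfin (φ := cutoff y (3 * r / 4) (7 * r / 8))
      (lipschitzWith_cutoff hlt).continuous cutoff_nonneg cutoff_le_one fun z hz => by
        refine cutoff_eq_zero hlt ?_
        by_contra! hzy
        have hmem : z ∈ A ∩ (ball x (9 * R / 20) \ ball x (R / 4)) := by
          refine ⟨hz, ?_, fun hz' => ?_⟩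
          · rw [mem_ball]
            linarith [dist_triangle z y x, dist_comm x y]
          · rw [mem_ball] at hz'
            linarith [dist_triangle x z y, dist_comm x z]
        rw [hA'] at hmem
        exact hmem
    calc _ ≤ 2 * ENNReal.ofReal Cd * (ENNReal.ofReal Cd ^ (k + 1) *
          ENNReal.ofReal (8 * CP * τ) * μ (F ∩ ball y r)) := by
          gcongr
          exact h.measure_inter_ball_half_le hFm htv.ne hr hτ hτlam hk hk' hmin hdens
      _ = 2 * ENNReal.ofReal Cd * (ENNReal.ofReal Cd ^ (k + 1) *
          ENNReal.ofReal (8 * CP * τ)) * μ (F ∩ ball y r) := by ring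
      _ ≤ 1 * μ (F ∩ ball y r) := by gcongr
      _ = _ := one_mul _

end Main

/-- **Smallness in annuli.** Let `B = B(x,R)` with `0 < R < (1/12) diam X` and suppose
`A ⊆ B` with `A ∩ (B(x,9R/20) ∖ B(x,R/4)) = ∅`. If `χ_E` solves the
`K_{A,0}(B(x,3R/2))`-obstacle problem, then for every `y` with `5R/16 ≤ d(x,y) < 2R/5`,
`χ_E^∨(y) ≤ C₄ R · cap₁(A, B(x,2R)) / μ(B(x,R))`, where `C₄` depends only on
`C_d`, `C_P`, `λ`. -/
theorem smallness_in_annuli :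
    ∀ (Cd CP lam : ℝ), ∃ C₄ : ℝ, 0 < C₄ ∧
      ∀ (X : Type*) [MetricSpace X] [MeasurableSpace X] [BorelSpace X]
        (μ : Measure X), MMS μ Cd CP lam →
        ∀ (x : X) (R : ℝ) (A E : Set X),
          0 < R → ENNReal.ofReal R < EMetric.diam (Set.univ : Set X) / 12 →
          A ⊆ Metric.ball x R →
          A ∩ (Metric.ball x (9 * R / 20) \ Metric.ball x (R / 4)) = ∅ →
          IsObstacleSolution μ (fun y => ((chi A y : ℝ) : EReal)) (fun _ => (0 : ℝ))
            (Metric.ball x (3 * R / 2)) (chi E) →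
          ∀ y : X, 5 * R / 16 ≤ dist x y → dist x y < 2 * R / 5 →
            upperApprox μ (chi E) y ≤
              ((ENNReal.ofReal (C₄ * R) * vcap1 μ A (Metric.ball x (2 * R))
                  / μ (Metric.ball x R) : ℝ≥0∞) : EReal) := by
  intro Cd CP lam
  by_cases hconst : 1 ≤ Cd ∧ 0 < CP ∧ 1 ≤ lam
  swap
  · exact ⟨1, one_pos, fun X _ _ _ μ h => absurd ⟨h.hCd, h.hCP, h.hlam⟩ hconst⟩
  obtain ⟨hCd, hCP, hlam⟩ := hconst
  obtain ⟨k, hk⟩ := pow_unbounded_of_one_lt (2 * lam) one_lt_two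
  obtain ⟨τ, k', hτ, hτlam, hk', hdecay⟩ := exists_scale hCd hCP hlam k
  set D : ℝ≥0∞ := ENNReal.ofReal Cd ^ 5 * (2 * ENNReal.ofReal Cd ^ k' * massConst Cd CP k) with hD
  have hDtop : D ≠ ⊤ := ENNReal.mul_ne_top (by simp)
    (ENNReal.mul_ne_top (ENNReal.mul_ne_top (by simp) (by simp)) massConst_ne_top)
  refine ⟨D.toReal + 1, by positivity, fun X _ _ _ μ h x R A E hR hdiam hA hA' hE y hy1 hy2 => ?_⟩
  have := h.properSpace
  set V := vcap1 μ A (ball x (2 * R)) with hV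
  set C := ENNReal.ofReal ((D.toReal + 1) * R) with hC
  have hC0 : C ≠ 0 := by rw [hC, ENNReal.ofReal_ne_zero_iff]; positivity
  have hCtop : C ≠ ⊤ := ENNReal.ofReal_ne_top
  have hDC : D * ENNReal.ofReal R ≤ C := by
    rw [hC, ENNReal.ofReal_mul (by positivity)]
    gcongr
    rw [← ENNReal.ofReal_toReal hDtop]
    exact ENNReal.ofReal_le_ofReal (by simp)
  by_cases hlarge : μ (ball x R) ≤ C * V
  · refine upperApprox_chi_le_one.trans ?_
    have : (1 : ℝ≥0∞) ≤ C * V / μ (ball x R) := by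
      rw [ENNReal.le_div_iff_mul_le (Or.inl (h.ball_pos x hR).ne')
        (Or.inl (h.ball_lt_top x R).ne), one_mul]
      exact hlarge
    exact_mod_cast this
  rw [not_le] at hlarge
  have hVlt : V < μ (ball x R) / C := by
    rwa [ENNReal.lt_div_iff_mul_lt (Or.inl hC0) (Or.inl hCtop), mul_comm]
  obtain ⟨u, g, hu, hu1, hu0, hg, hgu, hgb⟩ := exists_of_vcap1_lt hVlt
  obtain ⟨F, hEF, hFm, hFE⟩ := hE.1.nullMeasurableSet.exists_measurable_superset_ae_eq
  have hF := hE.congr_ae (u' := chi F) (indicator_ae_eq_of_ae_eq_set hFE.symm)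
  have hdiam' : ENNReal.ofReal (6 * R) < ediam (univ : Set X) := by
    rw [ENNReal.lt_div_iff_mul_lt (by simp) (by simp)] at hdiam
    refine lt_of_le_of_lt ?_ hdiam
    rw [mul_comm 6 R, ENNReal.ofReal_mul hR.le]
    gcongr
    norm_num
  obtain ⟨htv, hmF⟩ := h.tv_measure_le_of_isObstacleSolution hR hdiam' hA hFm hF hu hu1 hu0 hg hgu
    hgb hk.le
  have hbtop : μ (ball x R) / C ≠ ⊤ := ENNReal.div_ne_top (h.ball_lt_top x R).ne hC0
  have hfin : μ F ≠ ⊤ := ne_top_of_le_ne_top (ENNReal.mul_ne_top massConst_ne_top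
    (ENNReal.mul_ne_top ENNReal.ofReal_ne_top hbtop)) hmF
  refine (upperApprox_chi_le_zero hEF (h.tendsto_density_zero_of_isObstacleSolution hR hA' hFm
    hF htv hfin hy1 hy2 hτ hτlam hk.le hk' hdecay ?_)).trans (EReal.coe_ennreal_nonneg _)
  calc _ ≤ ENNReal.ofReal Cd ^ 5 * (2 * ENNReal.ofReal Cd ^ k' *
        (massConst Cd CP k * (ENNReal.ofReal R * (μ (ball x R) / C)))) := by gcongr
    _ = D * ENNReal.ofReal R * (μ (ball x R) / C) := by rw [hD]; ring
    _ ≤ C * (μ (ball x R) / C) := by gcongr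
    _ = _ := ENNReal.mul_div_cancel hC0 hCtop

end MetricBV
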